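/- Let a ∈ ℤ − {0,1} be squarefree and such that 2 does not ramify in the ring of integers of ℚ(√a) (equivalently, a ≡ 1 mod 4). Let r be a prime such that p ≢ 1 (mod r) for every prime p dividing a. Then the set of positive integers k for which there exist y, z, t ∈ ℚ with y² − a z² = t^r + k and t^r + k ≠ 0 has natural density 1; that is, lim_{N→∞} (1/N) · #{ 1 ≤ k ≤ N : ∃ y, z, t ∈ ℚ, y² − a z² = t^r + k ≠ 0 } = 1. -/

import Mathlib

open Filter

section DensityOne

open Finset

lemma card_Ioc_filter_modEq_le {q v Y J : ℤ} (hq : 0 < q) (hJ : 0 ≤ J) :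
    (((Ioc Y (Y + J)).filter fun y => y ≡ v [ZMOD q]).card : ℝ) ≤ J / q + 1 := by
  have hq' : (0 : ℚ) < q := by exact_mod_cast hq
  have hJ' : (0 : ℚ) ≤ J := by exact_mod_cast hJ
  have h := Int.Ioc_filter_modEq_card Y (Y + J) hq v
  have h1 : (((Ioc Y (Y + J)).filter fun y => y ≡ v [ZMOD q]).card : ℚ) ≤ J / q + 1 := by
    have : (((Ioc Y (Y + J)).filter fun y => y ≡ v [ZMOD q]).card : ℚ) =
      ((max (⌊(((Y + J : ℤ) : ℚ) - v) / q⌋ - ⌊((Y : ℚ) - v) / q⌋) 0 : ℤ) : ℚ) := by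
      rw [← h]; simp
    rw [this, Int.cast_max, max_le_iff]
    refine ⟨?_, by push_cast; positivity⟩
    have a1 := Int.floor_le ((((Y + J : ℤ) : ℚ) - v) / q)
    have a2 := Int.lt_floor_add_one (((Y : ℚ) - v) / q)
    have a3 : (((Y + J : ℤ) : ℚ) - v) / q = ((Y : ℚ) - v) / q + J / q := by
      push_cast; ring
    push_cast at *
    linarith
  exact_mod_cast h1

/-- The number of solutions of a linear congruence in an interval. -/
lemma card_Ioc_filter_dvd_le {s b c Y J : ℤ} (hs : 0 < s) (hJ : 0 ≤ J) :
    (((Ioc Y (Y + J)).filter fun y => s ∣ b * y + c).card : ℝ) ≤ J * (Int.gcd b s) / s + 1 := by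
  have hs' : (0 : ℝ) < s := by exact_mod_cast hs
  have hJ' : (0 : ℝ) ≤ J := by exact_mod_cast hJ
  rcases ((Ioc Y (Y + J)).filter fun y => s ∣ b * y + c).eq_empty_or_nonempty with h0 | ⟨v, hv⟩
  · rw [h0]
    simp only [card_empty, Nat.cast_zero]; positivity
  have hv2 := (mem_filter.1 hv).2
  have hG : 0 < Int.gcd b s := Int.gcd_pos_of_ne_zero_right _ hs.ne'
  have hGZ : (0 : ℤ) < Int.gcd b s := by exact_mod_cast hG
  obtain ⟨q, hq⟩ : (Int.gcd b s : ℤ) ∣ s := Int.gcd_dvd_right _ _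
  have hq0 : 0 < q := by
    by_contra hcon
    nlinarith
  have hqdiv : s / (Int.gcd s b : ℤ) = q := by
    rw [Int.gcd_comm]
    exact Int.ediv_eq_of_eq_mul_right hGZ.ne' hq
  have hsub : ((Ioc Y (Y + J)).filter fun y => s ∣ b * y + c) ⊆
      (Ioc Y (Y + J)).filter fun y => y ≡ v [ZMOD q] := by
    intro y hy
    rw [mem_filter] at hy ⊢
    refine ⟨hy.1, ?_⟩
    rw [← hqdiv]
    apply Int.ModEq.cancel_left_div_gcd hs (c := b)
    rw [Int.modEq_iff_dvd]
    have := dvd_sub hv2 hy.2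
    rwa [add_sub_add_right_eq_sub] at this
  calc (((Ioc Y (Y + J)).filter fun y => s ∣ b * y + c).card : ℝ)
      ≤ ((Ioc Y (Y + J)).filter fun y => y ≡ v [ZMOD q]).card := by
        exact_mod_cast card_le_card hsub
    _ ≤ J / q + 1 := card_Ioc_filter_modEq_le hq0 hJ
    _ = J * (Int.gcd b s) / s + 1 := by
        have e1 : (s : ℝ) = (Int.gcd b s : ℝ) * q := by exact_mod_cast hq
        have : (0:ℝ) < (Int.gcd b s : ℝ) := by exact_mod_cast hG
        have : (0:ℝ) < (q : ℝ) := by exact_mod_cast hq0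
        rw [e1]
        field_simp

lemma card_Icc_filter_even_le {n c : ℤ} (hn : 0 ≤ n) :
    (((Icc (-n) n).filter fun e => Even (e + c)).card : ℝ) ≤ n + 1 := by
  have h := card_Ioc_filter_modEq_le (q := 2) (v := c) (Y := -n - 1) (J := 2 * n + 1)
    (by norm_num) (by lia)
  have e : ((Icc (-n) n).filter fun e => Even (e + c)) =
      (Ioc (-n - 1) (-n - 1 + (2 * n + 1))).filter fun y => y ≡ c [ZMOD 2] := by
    ext y
    rw [mem_filter, mem_filter, mem_Icc, mem_Ioc, Int.even_iff, Int.ModEq]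
    lia
  rw [← e] at h
  have : ((((Icc (-n) n).filter fun e => Even (e + c)).card : ℤ) : ℝ) < ((n + 2 : ℤ) : ℝ) := by
    push_cast at h ⊢
    linarith
  have h2 := Int.cast_lt.1 this
  exact_mod_cast (by lia : (((Icc (-n) n).filter fun e => Even (e + c)).card : ℤ) ≤ n + 1)

lemma card_Icc_filter_dvd_le {n : ℤ} {l : ℕ} (hn : 0 ≤ n) (hl : 0 < l) :
    (((Icc (-n) n).filter fun e => e ≠ 0 ∧ (l : ℤ) ∣ e).card : ℝ) ≤ 2 * n / l := by
  have hl' : (0 : ℤ) < l := by exact_mod_cast hl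
  have hsub : ((Icc (-n) n).filter fun e => e ≠ 0 ∧ (l : ℤ) ∣ e) ⊆
      ((Icc (-(n / l)) (n / l)).erase 0).image fun j => (l : ℤ) * j := by
    intro e he
    simp only [mem_filter, mem_Icc] at he
    obtain ⟨⟨h1, h2⟩, h0, j, rfl⟩ := he
    refine mem_image.2 ⟨j, mem_erase.2 ⟨by rintro rfl; simp at h0, mem_Icc.2 ⟨?_, ?_⟩⟩, rfl⟩
    · rw [neg_le, Int.le_ediv_iff_mul_le hl']
      linarith
    · rw [Int.le_ediv_iff_mul_le hl']
      linarith
  have hd : 0 ≤ n / (l : ℤ) := Int.ediv_nonneg hn hl'.le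
  have hc := (card_le_card hsub).trans card_image_le
  rw [card_erase_of_mem (by simp [hd]), Int.card_Icc] at hc
  have h3 : (((Icc (-n) n).filter fun e => e ≠ 0 ∧ (l : ℤ) ∣ e).card : ℤ) ≤ 2 * (n / l) := by lia
  have h4 : (n / (l : ℤ)) * l ≤ n := Int.ediv_mul_le _ hl'.ne'
  have hlR : (0 : ℝ) < l := by exact_mod_cast hl
  rw [le_div_iff₀ hlR]
  have h5 : (((Icc (-n) n).filter fun e => e ≠ 0 ∧ (l : ℤ) ∣ e).card : ℤ) * l ≤ 2 * n := by
    nlinarith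
  exact_mod_cast h5

lemma sum_Ioc_min_eq {Z : ℕ} :
    ∑ σ ∈ Ioc (2 * (Z : ℤ)) (2 * Z + 2 * Z), min (σ - 2 * Z) (4 * Z - σ) = (Z : ℤ) ^ 2 := by
  have h : ∑ σ ∈ Ioc (2 * (Z : ℤ)) (2 * Z + 2 * Z), min (σ - 2 * Z) (4 * Z - σ) =
      ∑ j ∈ range (Z + Z), min ((j : ℤ) + 1) (2 * Z - (j + 1)) := by
    symm
    apply sum_nbij (fun j : ℕ => 2 * (Z : ℤ) + j + 1)
    · intro j hj; simp only [mem_range, mem_Ioc] at *; lia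
    · intro j _ k _ hjk; simp only at hjk; lia
    · intro σ hσ
      simp only [coe_Ioc, Set.mem_Ioc, Set.mem_image, coe_range, Set.mem_Iio] at *
      exact ⟨(σ - 2 * Z - 1).toNat, by lia, by lia⟩
    · intro j hj; congr 1 <;> ring
  rw [h, sum_range_add, ← sum_add_distrib]
  calc ∑ j ∈ range Z, (min ((j : ℤ) + 1) (2 * Z - (j + 1)) +
        min (((Z + j : ℕ) : ℤ) + 1) (2 * Z - (((Z + j : ℕ) : ℤ) + 1))) = ∑ j ∈ range Z, (Z : ℤ) := by
        apply sum_congr rfl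
        intro j hj
        rw [mem_range] at hj
        push_cast
        lia
    _ = (Z : ℤ) ^ 2 := by simp [sq]

lemma exists_eq_mul_of_collision {κ β A h y₁ y₂ x₁ x₂ : ℤ} (hA : A ≠ 0)
    (hcA : ∀ m, IsCoprime (1 + κ * m) A)
    (H : (y₁ + κ * y₁ ^ 2) - (y₂ + κ * y₂ ^ 2) =
      A * ((x₁ + β * x₁ ^ 2) - (x₂ + β * x₂ ^ 2) + h)) :
    ∃ e, y₁ = y₂ + A * e ∧
      e * (1 + κ * (y₁ + y₂)) = (x₁ - x₂) * (1 + β * (x₁ + x₂)) + h := by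
  have h1 : (1 + κ * (y₁ + y₂)) * (y₁ - y₂) =
      A * ((x₁ - x₂) * (1 + β * (x₁ + x₂)) + h) := by linear_combination H
  obtain ⟨e, he⟩ := (hcA (y₁ + y₂)).symm.dvd_of_dvd_mul_left (Dvd.intro _ h1.symm)
  refine ⟨e, by linarith, ?_⟩
  rw [he] at h1
  exact mul_left_cancel₀ hA (by linear_combination h1)

/-- The number of admissible `y` for a fixed difference `e` and a fixed sum `σ`. -/
lemma card_filter_dvd_collision_le {κ A Y J h s e : ℤ} (hs : 0 < s) (hJ : 0 ≤ J)
    (hcκ : IsCoprime s (2 * κ)) (he : e ≠ 0) (D : Finset ℕ)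
    (hD : 2 ≤ Int.gcd e s → (Int.gcd e s : ℤ) ∣ h → Int.gcd e s ∈ D) :
    (((Ioc Y (Y + J)).filter fun y => s ∣ e * (1 + κ * (2 * y + A * e)) - h).card : ℝ) ≤
      (J : ℝ) / s + 1 + ∑ l ∈ D.filter fun l : ℕ => (l : ℤ) ∣ s ∧ (l : ℤ) ∣ e, (J : ℝ) * l / s := by
  have hs' : (0 : ℝ) < s := by exact_mod_cast hs
  have hJ' : (0 : ℝ) ≤ J := by exact_mod_cast hJ
  have hsum : 0 ≤ ∑ l ∈ D.filter fun l : ℕ => (l : ℤ) ∣ s ∧ (l : ℤ) ∣ e, (J : ℝ) * l / s :=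
    sum_nonneg fun _ _ => by positivity
  rcases ((Ioc Y (Y + J)).filter fun y =>
    s ∣ e * (1 + κ * (2 * y + A * e)) - h).eq_empty_or_nonempty with h0 | ⟨v, hv⟩
  · rw [h0, card_empty, Nat.cast_zero]; positivity
  have hv2 := (mem_filter.1 hv).2
  have hGh : (Int.gcd e s : ℤ) ∣ h := by
    have h1 : (Int.gcd e s : ℤ) ∣ e * (1 + κ * (2 * v + A * e)) :=
      (Int.gcd_dvd_left _ _).mul_right _
    have h2 := dvd_sub h1 ((Int.gcd_dvd_right e s).trans hv2)
    rwa [sub_sub_cancel] at h2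
  have hgcd : Int.gcd (2 * κ * e) s = Int.gcd e s := by
    rw [Int.gcd_def, Int.gcd_def, Int.natAbs_mul]
    exact Nat.Coprime.gcd_mul_left_cancel _ (Int.isCoprime_iff_nat_coprime.1 hcκ).symm
  have hcard := card_Ioc_filter_dvd_le (s := s) (b := 2 * κ * e)
    (c := e * (1 + κ * (A * e)) - h) (Y := Y) hs hJ
  rw [hgcd] at hcard
  have hset : ((Ioc Y (Y + J)).filter fun y => s ∣ e * (1 + κ * (2 * y + A * e)) - h) =
      (Ioc Y (Y + J)).filter fun y => s ∣ 2 * κ * e * y + (e * (1 + κ * (A * e)) - h) := by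
    apply filter_congr
    intro y _
    rw [show e * (1 + κ * (2 * y + A * e)) - h =
      2 * κ * e * y + (e * (1 + κ * (A * e)) - h) by ring]
  rw [hset]
  refine hcard.trans ?_
  have hG0 : 0 < Int.gcd e s := Int.gcd_pos_of_ne_zero_left _ he
  rcases (by lia : Int.gcd e s = 1 ∨ 2 ≤ Int.gcd e s) with hG | hG
  · rw [hG]; simpa using hsum
  · have hmem : Int.gcd e s ∈ D.filter fun l : ℕ => (l : ℤ) ∣ s ∧ (l : ℤ) ∣ e :=
      mem_filter.2 ⟨hD hG hGh, Int.gcd_dvd_right _ _, Int.gcd_dvd_left _ _⟩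
    have := single_le_sum (f := fun l : ℕ => (J : ℝ) * l / s)
      (fun _ _ => by positivity) hmem
    have : 0 ≤ (J : ℝ) / s := by positivity
    linarith

/-- Quadruples `(y₁, y₂, x₁, x₂)` on which two values of the quadratic family differ by `A * h`. -/
noncomputable def collisions (κ β A Y J Z h : ℤ) : Finset (ℤ × ℤ × ℤ × ℤ) :=
  (Ioc Y (Y + J) ×ˢ Ioc Y (Y + J) ×ˢ Ioc Z (2 * Z) ×ˢ Ioc Z (2 * Z)).filter fun v =>
    (v.1 + κ * v.1 ^ 2) - (v.2.1 + κ * v.2.1 ^ 2) =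
      A * ((v.2.2.1 + β * v.2.2.1 ^ 2) - (v.2.2.2 + β * v.2.2.2 ^ 2) + h)

/-- The bound for `|y₁ - y₂| / |A|` over the collisions with `x₁ + x₂ = σ`. -/
noncomputable def diffBound (κ β Y Z h σ : ℤ) : ℤ :=
  ((1 + β * σ) * min (σ - 2 * Z) (4 * Z - σ) + |h|) / (2 * κ * Y)

lemma card_collisions_filter_ne_le {κ β A Y J Z h : ℤ} (hκ : 0 < κ) (hβ : 0 < β) (hA : A ≠ 0)
    (hY : 0 < Y) (hZ : 0 < Z) (hκ2 : Even κ) (hβ2 : Even β)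
    (hcA : ∀ m, IsCoprime (1 + κ * m) A) :
    ((collisions κ β A Y J Z h).filter fun v => v.1 ≠ v.2.1).card ≤
      ∑ σ ∈ Ioc (2 * Z) (2 * Z + 2 * Z),
        ∑ e ∈ (Icc (-diffBound κ β Y Z h σ) (diffBound κ β Y Z h σ)).filter
            fun e => e ≠ 0 ∧ Even (e + (σ + h)),
          ((Ioc Y (Y + J)).filter fun y =>
            1 + β * σ ∣ e * (1 + κ * (2 * y + A * e)) - h).card := by
  have key : ((collisions κ β A Y J Z h).filter fun v => v.1 ≠ v.2.1).card ≤
      ((Ioc (2 * Z) (2 * Z + 2 * Z)).sigma fun σ =>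
        ((Icc (-diffBound κ β Y Z h σ) (diffBound κ β Y Z h σ)).filter
            fun e => e ≠ 0 ∧ Even (e + (σ + h))).sigma fun e =>
          (Ioc Y (Y + J)).filter fun y =>
            1 + β * σ ∣ e * (1 + κ * (2 * y + A * e)) - h).card := by
    apply card_le_card_of_injOn (fun v => ⟨v.2.2.1 + v.2.2.2, (v.1 - v.2.1) / A, v.2.1⟩)
    · rintro ⟨y₁, y₂, x₁, x₂⟩ hv
      simp only [collisions, coe_filter, mem_filter, mem_product, mem_Ioc,
        Set.mem_ofPred_eq] at hv
      obtain ⟨⟨⟨hy₁, hy₂, hx₁, hx₂⟩, H⟩, hne⟩ := hv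
      obtain ⟨e, rfl, he⟩ := exists_eq_mul_of_collision hA hcA H
      have hdiv : (y₂ + A * e - y₂) / A = e := by
        rw [add_sub_cancel_left, Int.mul_ediv_cancel_left _ hA]
      simp only [hdiv, coe_sigma, Set.mem_sigma_iff, coe_Ioc, Set.mem_Ioc, coe_filter, mem_Icc,
        Set.mem_ofPred_eq, mem_Ioc]
      have he0 : e ≠ 0 := by rintro rfl; simp at hne
      refine ⟨by lia, ⟨?_, he0, ?_⟩, hy₂, ?_⟩
      · rw [← abs_le, diffBound, Int.le_ediv_iff_mul_le (by positivity)]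
        have hg : 2 * κ * Y ≤ 1 + κ * (y₂ + A * e + y₂) := by nlinarith
        have hs : 0 < 1 + β * (x₁ + x₂) := by nlinarith
        have hd : |x₁ - x₂| ≤ min (x₁ + x₂ - 2 * Z) (4 * Z - (x₁ + x₂)) := by
          rw [abs_le, le_min_iff]; lia
        calc |e| * (2 * κ * Y) ≤ |e| * |1 + κ * (y₂ + A * e + y₂)| := by
              gcongr; exact hg.trans (le_abs_self _)
          _ = |(x₁ - x₂) * (1 + β * (x₁ + x₂)) + h| := by rw [← abs_mul, he]
          _ ≤ |(x₁ - x₂) * (1 + β * (x₁ + x₂))| + |h| := abs_add_le _ _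
          _ = (1 + β * (x₁ + x₂)) * |x₁ - x₂| + |h| := by
              rw [abs_mul, abs_of_pos hs, mul_comm]
          _ ≤ _ := by gcongr
      · have hpar := congrArg Even he
        simp only [Int.even_add, Int.even_mul, Int.even_sub, hκ2, hβ2, Int.not_even_one, true_or,
          iff_true, or_false, eq_iff_iff] at hpar ⊢
        tauto
      · exact ⟨x₁ - x₂, by linear_combination he⟩
    · rintro ⟨y₁, y₂, x₁, x₂⟩ hv ⟨y₁', y₂', x₁', x₂'⟩ hv' heq
      simp only [collisions, coe_filter, mem_filter, mem_product, mem_Ioc,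
        Set.mem_ofPred_eq] at hv hv'
      obtain ⟨⟨⟨hy₁, hy₂, hx₁, hx₂⟩, H⟩, hne⟩ := hv
      obtain ⟨⟨⟨hy₁', hy₂', hx₁', hx₂'⟩, H'⟩, hne'⟩ := hv'
      obtain ⟨e, rfl, he⟩ := exists_eq_mul_of_collision hA hcA H
      obtain ⟨e', rfl, he'⟩ := exists_eq_mul_of_collision hA hcA H'
      simp only [add_sub_cancel_left, Int.mul_ediv_cancel_left _ hA, Sigma.mk.injEq,
        heq_eq_eq] at heq
      obtain ⟨hσ, rfl, rfl⟩ := heq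
      have hs : (1 + β * (x₁ + x₂)) ≠ 0 := by nlinarith
      have hd : x₁ - x₂ = x₁' - x₂' := by
        rw [← hσ] at he'
        exact mul_right_cancel₀ hs (by linear_combination he' - he)
      have h1 : x₁ = x₁' := by lia
      have h2 : x₂ = x₂' := by lia
      rw [h1, h2]
  simpa only [card_sigma] using key

lemma card_collisions_filter_ne_le_real {κ β A Y J Z h E : ℤ} (hκ : 0 < κ) (hβ : 0 < β)
    (hA : A ≠ 0) (hY : 0 < Y) (hJ : 0 ≤ J) (hZ : 0 < Z) (hκ2 : Even κ) (hβ2 : Even β)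
    (hcA : ∀ m, IsCoprime (1 + κ * m) A) (hcβ : ∀ m, IsCoprime (1 + β * m) (2 * κ))
    (hE : (1 + 4 * β * Z) * Z + |h| ≤ 2 * κ * Y * E) (D : Finset ℕ) (hD0 : ∀ l ∈ D, 0 < l)
    (hD : ∀ l : ℕ, 2 ≤ l → (l : ℤ) ∣ h → IsCoprime (l : ℤ) β → (l : ℤ) ≤ E → l ∈ D) :
    (((collisions κ β A Y J Z h).filter fun v => v.1 ≠ v.2.1).card : ℝ) ≤
      (J / (2 * κ * Y)) * (Z ^ 2 + 2 * Z * |h|) + J / β + 4 * Z * E +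
        ∑ l ∈ D, (2 * Z / (l : ℝ) + 1) * (2 * (J / (2 * κ * Y)) * (Z + |h|)) := by
  have hκR : (0 : ℝ) < κ := by exact_mod_cast hκ
  have hβR : (0 : ℝ) < β := by exact_mod_cast hβ
  have hYR : (0 : ℝ) < Y := by exact_mod_cast hY
  have hZR : (0 : ℝ) < Z := by exact_mod_cast hZ
  have hJR : (0 : ℝ) ≤ J := by exact_mod_cast hJ
  set X : ℝ := J / (2 * κ * Y) with hX
  have hX0 : 0 ≤ X := by positivity
  set n := diffBound κ β Y Z h with hn
  have hσ : ∀ σ ∈ Ioc (2 * Z) (2 * Z + 2 * Z), 2 * Z < σ ∧ σ ≤ 4 * Z := by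
    intro σ h; rw [mem_Ioc] at h; lia
  have hm0 : ∀ σ ∈ Ioc (2 * Z) (2 * Z + 2 * Z), 0 ≤ min (σ - 2 * Z) (4 * Z - σ) := by
    intro σ h; have := hσ σ h; rw [le_min_iff]; lia
  have hmZ : ∀ σ, min (σ - 2 * Z) (4 * Z - σ) ≤ Z := by
    intro σ; rw [min_le_iff]; lia
  have hs : ∀ σ ∈ Ioc (2 * Z) (2 * Z + 2 * Z), 2 * β * Z ≤ 1 + β * σ ∧ 1 ≤ 1 + β * σ := by
    intro σ h; have := hσ σ h; constructor <;> nlinarith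
  have hn0 : ∀ σ ∈ Ioc (2 * Z) (2 * Z + 2 * Z), 0 ≤ n σ := by
    intro σ h
    have h1 := hm0 σ h
    have h2 := (hs σ h).2
    exact Int.ediv_nonneg (by positivity) (by positivity)
  have hnle : ∀ σ ∈ Ioc (2 * Z) (2 * Z + 2 * Z),
      n σ * (2 * κ * Y) ≤ (1 + β * σ) * min (σ - 2 * Z) (4 * Z - σ) + |h| := by
    intro σ _
    exact Int.ediv_mul_le _ (by positivity)
  have hnE : ∀ σ ∈ Ioc (2 * Z) (2 * Z + 2 * Z), n σ ≤ E := by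
    intro σ h'
    have h1 := hnle σ h'
    have h2 := hm0 σ h'
    have h3 := hmZ σ
    have h4 := (hs σ h').2
    have h5 := (hσ σ h').2
    have h6 : 1 + β * σ ≤ 1 + 4 * β * Z := by nlinarith
    have h7 : (1 + β * σ) * min (σ - 2 * Z) (4 * Z - σ) ≤ (1 + 4 * β * Z) * Z := by gcongr
    have h8 : n σ * (2 * κ * Y) ≤ E * (2 * κ * Y) := by linarith
    exact le_of_mul_le_mul_right h8 (by positivity)
  -- the quotient `n σ / s`, scaled by `J`
  have hJn : ∀ σ ∈ Ioc (2 * Z) (2 * Z + 2 * Z), (J : ℝ) / ((1 + β * σ : ℤ) : ℝ) * n σ ≤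
      X * ((min (σ - 2 * Z) (4 * Z - σ) : ℤ) + |(h : ℝ)|) := by
    intro σ h'
    have h4 : (1 : ℝ) ≤ ((1 + β * σ : ℤ) : ℝ) := by exact_mod_cast (hs σ h').2
    have h1 : (n σ : ℝ) * (2 * κ * Y) ≤ ((1 + β * σ : ℤ) : ℝ) *
        (min (σ - 2 * Z) (4 * Z - σ) : ℤ) + |(h : ℝ)| := by exact_mod_cast hnle σ h'
    have h5 : |(h : ℝ)| ≤ ((1 + β * σ : ℤ) : ℝ) * |(h : ℝ)| :=
      le_mul_of_one_le_left (abs_nonneg _) h4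
    have h6 : (n σ : ℝ) / ((1 + β * σ : ℤ) : ℝ) ≤
        ((min (σ - 2 * Z) (4 * Z - σ) : ℤ) + |(h : ℝ)|) / (2 * κ * Y) := by
      rw [div_le_div_iff₀ (by linarith) (by positivity)]
      nlinarith
    calc (J : ℝ) / ((1 + β * σ : ℤ) : ℝ) * n σ = J * (n σ / ((1 + β * σ : ℤ) : ℝ)) := by ring
      _ ≤ J * (((min (σ - 2 * Z) (4 * Z - σ) : ℤ) + |(h : ℝ)|) / (2 * κ * Y)) := by gcongr
      _ = _ := by rw [hX]; ring
  have hinner : ∀ σ ∈ Ioc (2 * Z) (2 * Z + 2 * Z),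
      ∑ e ∈ (Icc (-n σ) (n σ)).filter fun e => e ≠ 0 ∧ Even (e + (σ + h)),
        (((Ioc Y (Y + J)).filter fun y =>
          1 + β * σ ∣ e * (1 + κ * (2 * y + A * e)) - h).card : ℝ) ≤
      X * ((min (σ - 2 * Z) (4 * Z - σ) : ℤ) + |(h : ℝ)|) + J / (2 * β * Z) + 2 * E +
        ∑ l ∈ D.filter fun l : ℕ => (l : ℤ) ∣ 1 + β * σ, 2 * X * (Z + |(h : ℝ)|) := by
    intro σ h'
    have hspos : 0 < 1 + β * σ := (hs σ h').2
    have hsR : (0 : ℝ) < ((1 + β * σ : ℤ) : ℝ) := by exact_mod_cast hspos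
    have hstep : ∀ e ∈ (Icc (-n σ) (n σ)).filter fun e => e ≠ 0 ∧ Even (e + (σ + h)),
        (((Ioc Y (Y + J)).filter fun y =>
          1 + β * σ ∣ e * (1 + κ * (2 * y + A * e)) - h).card : ℝ) ≤
        (J / ((1 + β * σ : ℤ) : ℝ) + 1) + ∑ l ∈ D.filter fun l : ℕ => (l : ℤ) ∣ 1 + β * σ,
          if (l : ℤ) ∣ e then (J : ℝ) * l / ((1 + β * σ : ℤ) : ℝ) else 0 := by
      intro e he
      simp only [mem_filter, mem_Icc] at he
      refine (card_filter_dvd_collision_le hspos hJ (hcβ σ) he.2.1 D ?_).trans ?_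
      · intro h2 hG
        refine hD _ h2 hG ?_ ?_
        · refine IsCoprime.of_isCoprime_of_dvd_left ?_ (Int.gcd_dvd_right e (1 + β * σ))
          exact ⟨1, -σ, by ring⟩
        · have h3 := Int.le_of_dvd (abs_pos.2 he.2.1)
            ((dvd_abs _ _).2 (Int.gcd_dvd_left e (1 + β * σ)))
          have h4 := abs_le.2 he.1
          exact h3.trans (h4.trans (hnE σ h'))
      · rw [← sum_filter, filter_filter]
    refine (sum_le_sum hstep).trans ?_
    rw [sum_add_distrib, sum_comm, sum_const, nsmul_eq_mul]
    have hc1 : ((((Icc (-n σ) (n σ)).filter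
        fun e => e ≠ 0 ∧ Even (e + (σ + h))).card : ℕ) : ℝ) ≤ n σ + 1 := by
      refine le_trans ?_ (card_Icc_filter_even_le (c := σ + h) (hn0 σ h'))
      exact_mod_cast card_le_card (fun e he => by
        simp only [mem_filter] at he ⊢; exact ⟨he.1, he.2.2⟩)
    have hc2 : ((((Icc (-n σ) (n σ)).filter
        fun e => e ≠ 0 ∧ Even (e + (σ + h))).card : ℕ) : ℝ) ≤ 2 * E := by
      have h1 := card_Icc_filter_dvd_le (l := 1) (hn0 σ h') one_pos
      have h2 : (n σ : ℝ) ≤ E := by exact_mod_cast hnE σ h'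
      have h3 : ((((Icc (-n σ) (n σ)).filter
        fun e => e ≠ 0 ∧ Even (e + (σ + h))).card : ℕ) : ℝ) ≤
          (((Icc (-n σ) (n σ)).filter fun e => e ≠ 0 ∧ ((1 : ℕ) : ℤ) ∣ e).card : ℝ) := by
        exact_mod_cast card_le_card (fun e he => by
          simp only [mem_filter] at he ⊢; exact ⟨he.1, he.2.1, by simp⟩)
      simp only [Nat.cast_one, div_one] at h1 h3
      linarith
    have hl : ∀ l ∈ D.filter fun l : ℕ => (l : ℤ) ∣ 1 + β * σ,
        ∑ e ∈ (Icc (-n σ) (n σ)).filter fun e => e ≠ 0 ∧ Even (e + (σ + h)),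
          (if (l : ℤ) ∣ e then (J : ℝ) * l / ((1 + β * σ : ℤ) : ℝ) else 0) ≤
        2 * X * (Z + |(h : ℝ)|) := by
      intro l hlD
      have hl0 : 0 < l := hD0 l (mem_filter.1 hlD).1
      have hlR : (0 : ℝ) < l := by exact_mod_cast hl0
      rw [← sum_filter, sum_const, nsmul_eq_mul]
      have h1 := card_Icc_filter_dvd_le (hn0 σ h') hl0
      have h3 : (((((Icc (-n σ) (n σ)).filter fun e => e ≠ 0 ∧ Even (e + (σ + h))).filter
          fun e => (l : ℤ) ∣ e).card : ℕ) : ℝ) ≤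
          (((Icc (-n σ) (n σ)).filter fun e => e ≠ 0 ∧ (l : ℤ) ∣ e).card : ℝ) := by
        exact_mod_cast card_le_card (fun e he => by
          simp only [mem_filter] at he ⊢; exact ⟨he.1.1, he.1.2.1, he.2⟩)
      have h4 : ((min (σ - 2 * Z) (4 * Z - σ) : ℤ) : ℝ) ≤ Z := by exact_mod_cast hmZ σ
      calc _ ≤ (2 * n σ / l) * ((J : ℝ) * l / ((1 + β * σ : ℤ) : ℝ)) := by
            gcongr; exact h3.trans h1
        _ = 2 * ((J : ℝ) / ((1 + β * σ : ℤ) : ℝ) * n σ) := by field_simp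
        _ ≤ 2 * (X * ((min (σ - 2 * Z) (4 * Z - σ) : ℤ) + |(h : ℝ)|)) := by
            gcongr 2 * ?_; exact hJn σ h'
        _ ≤ 2 * (X * (Z + |(h : ℝ)|)) := by gcongr
        _ = _ := by ring
    refine add_le_add ?_ (sum_le_sum hl)
    have hsZ : (J : ℝ) / ((1 + β * σ : ℤ) : ℝ) ≤ J / (2 * β * Z) := by
      have : (2 : ℝ) * β * Z ≤ ((1 + β * σ : ℤ) : ℝ) := by exact_mod_cast (hs σ h').1
      gcongr
    have hJs : 0 ≤ (J : ℝ) / ((1 + β * σ : ℤ) : ℝ) := by positivity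
    have := hJn σ h'
    nlinarith
  have hmain : (((collisions κ β A Y J Z h).filter fun v => v.1 ≠ v.2.1).card : ℝ) ≤
      ∑ σ ∈ Ioc (2 * Z) (2 * Z + 2 * Z),
        (X * ((min (σ - 2 * Z) (4 * Z - σ) : ℤ) + |(h : ℝ)|) + J / (2 * β * Z) + 2 * E +
        ∑ l ∈ D.filter fun l : ℕ => (l : ℤ) ∣ 1 + β * σ, 2 * X * (Z + |(h : ℝ)|)) := by
    refine le_trans ?_ (sum_le_sum hinner)
    exact_mod_cast card_collisions_filter_ne_le (J := J) (h := h) hκ hβ hA hY hZ hκ2 hβ2 hcA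
  refine hmain.trans ?_
  have hcard : (((Ioc (2 * Z) (2 * Z + 2 * Z)).card : ℕ) : ℝ) = 2 * Z := by
    rw [Int.card_Ioc, add_sub_cancel_left]
    have : (((2 * Z).toNat : ℤ) : ℝ) = ((2 * Z : ℤ) : ℝ) := by rw [Int.toNat_of_nonneg (by lia)]
    exact_mod_cast this
  have hmin : ∑ σ ∈ Ioc (2 * Z) (2 * Z + 2 * Z), ((min (σ - 2 * Z) (4 * Z - σ) : ℤ) : ℝ) =
      (Z : ℝ) ^ 2 := by
    have h1 := sum_Ioc_min_eq (Z := Z.toNat)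
    rw [Int.toNat_of_nonneg hZ.le] at h1
    exact_mod_cast h1
  rw [sum_add_distrib, sum_add_distrib, sum_add_distrib, ← mul_sum, sum_add_distrib, hmin,
    sum_const, sum_const, sum_const, nsmul_eq_mul, nsmul_eq_mul, nsmul_eq_mul, hcard]
  have hlast : ∑ σ ∈ Ioc (2 * Z) (2 * Z + 2 * Z),
      ∑ l ∈ D.filter fun l : ℕ => (l : ℤ) ∣ 1 + β * σ, 2 * X * (Z + |(h : ℝ)|) ≤
      ∑ l ∈ D, (2 * Z / (l : ℝ) + 1) * (2 * X * (Z + |(h : ℝ)|)) := by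
    simp_rw [sum_filter]
    rw [sum_comm]
    refine sum_le_sum fun l hlD => ?_
    rw [← sum_filter, sum_const, nsmul_eq_mul]
    gcongr
    have hl0 : (0 : ℤ) < l := by exact_mod_cast hD0 l hlD
    have hlR : (0 : ℝ) < l := by exact_mod_cast hD0 l hlD
    rcases ((Ioc (2 * Z) (2 * Z + 2 * Z)).filter
      fun σ => (l : ℤ) ∣ 1 + β * σ).eq_empty_or_nonempty with h0 | ⟨v, hv⟩
    · rw [h0, card_empty, Nat.cast_zero]; positivity
    have hcop : Int.gcd β l = 1 := by
      obtain ⟨q, hq⟩ := (mem_filter.1 hv).2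
      exact Int.isCoprime_iff_gcd_eq_one.1 ⟨-v, q, by linear_combination -hq⟩
    have h1 := card_Ioc_filter_dvd_le (s := l) (b := β) (c := 1) (Y := 2 * Z) (J := 2 * Z)
      hl0 (by lia)
    rw [hcop] at h1
    simp only [add_comm (1 : ℤ)]
    push_cast at h1
    simpa using h1
  have e1 : 2 * (Z : ℝ) * (J / (2 * β * Z)) = J / β := by field_simp
  push_cast
  linarith

lemma card_collisions_le {κ β A Y J Z h E : ℤ} (hκ : 0 < κ) (hβ : 0 < β)
    (hA : A ≠ 0) (hY : 0 < Y) (hJ : 0 ≤ J) (hZ : 0 < Z) (hκ2 : Even κ) (hβ2 : Even β)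
    (hcA : ∀ m, IsCoprime (1 + κ * m) A) (hcβ : ∀ m, IsCoprime (1 + β * m) (2 * κ))
    (hh : |h| ≤ Z)
    (hE : (1 + 4 * β * Z) * Z + |h| ≤ 2 * κ * Y * E) (D : Finset ℕ) (hD0 : ∀ l ∈ D, 0 < l)
    (hD : ∀ l : ℕ, 2 ≤ l → (l : ℤ) ∣ h → IsCoprime (l : ℤ) β → (l : ℤ) ≤ E → l ∈ D) :
    ((collisions κ β A Y J Z h).card : ℝ) ≤
      (J / (2 * κ * Y)) * (Z ^ 2 + 2 * Z * |h|) + J / β + 4 * Z * E +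
        ∑ l ∈ D, (2 * Z / (l : ℝ) + 1) * (2 * (J / (2 * κ * Y)) * (Z + |h|)) +
        (if h = 0 then (J : ℝ) * Z else 0) := by
  have hsplit := card_filter_add_card_filter_not (s := collisions κ β A Y J Z h)
    (fun v => v.1 ≠ v.2.1)
  have hoff := card_collisions_filter_ne_le_real hκ hβ hA hY hJ hZ hκ2 hβ2 hcA hcβ hE D hD0 hD
  rw [← hsplit, Nat.cast_add]
  refine add_le_add hoff ?_
  have hdiag : ∀ v ∈ (collisions κ β A Y J Z h).filter (fun v => ¬ v.1 ≠ v.2.1),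
      v.1 ∈ Ioc Y (Y + J) ∧ v.2.2.1 ∈ Ioc Z (2 * Z) ∧ v.2.1 = v.1 ∧ v.2.2.2 = v.2.2.1 ∧ h = 0 := by
    rintro ⟨y₁, y₂, x₁, x₂⟩ hv
    simp only [collisions, mem_filter, mem_product, not_not] at hv
    obtain ⟨⟨⟨hy₁, hy₂, hx₁, hx₂⟩, H⟩, rfl⟩ := hv
    rw [mem_Ioc] at hx₁ hx₂
    have h1 : A * ((x₁ - x₂) * (1 + β * (x₁ + x₂)) + h) = 0 := by linear_combination -H
    have h2 := (mul_eq_zero.1 h1).resolve_left hA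
    have hs : Z < 1 + β * (x₁ + x₂) := by nlinarith
    have hd : x₁ - x₂ = 0 := by
      by_contra hne
      have h3 : 1 ≤ |x₁ - x₂| := Int.one_le_abs hne
      have h4 : |x₁ - x₂| * (1 + β * (x₁ + x₂)) = |h| := by
        have : |(x₁ - x₂) * (1 + β * (x₁ + x₂))| = |h| := by
          rw [← abs_neg h]; congr 1; linarith
        rwa [abs_mul, abs_of_pos (hZ.trans hs)] at this
      nlinarith
    refine ⟨hy₁, mem_Ioc.2 hx₁, rfl, by simp only; lia, ?_⟩
    rw [hd] at h2; linarith
  split_ifs with h0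
  · have hcard : ((collisions κ β A Y J Z h).filter (fun v => ¬ v.1 ≠ v.2.1)).card ≤
        (Ioc Y (Y + J) ×ˢ Ioc Z (2 * Z)).card := by
      apply card_le_card_of_injOn (fun v => (v.1, v.2.2.1))
      · intro v hv
        have := hdiag v hv
        exact mem_coe.2 (mem_product.2 ⟨this.1, this.2.1⟩)
      · intro v hv v' hv' heq
        have h1 := hdiag v hv
        have h2 := hdiag v' hv'
        simp only [Prod.mk.injEq] at heq
        refine Prod.ext heq.1 (Prod.ext ?_ (Prod.ext heq.2 ?_))
        · rw [h1.2.2.1, h2.2.2.1, heq.1]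
        · rw [h1.2.2.2.1, h2.2.2.2.1, heq.2]
    rw [card_product, Int.card_Ioc, Int.card_Ioc] at hcard
    have h3 : (((Y + J - Y).toNat * (2 * Z - Z).toNat : ℕ) : ℤ) = J * Z := by
      rw [Nat.cast_mul, Int.toNat_of_nonneg (by lia), Int.toNat_of_nonneg (by lia)]; ring
    have h4 : (((collisions κ β A Y J Z h).filter (fun v => ¬ v.1 ≠ v.2.1)).card : ℤ) ≤ J * Z := by
      rw [← h3]; exact_mod_cast hcard
    exact_mod_cast h4
  · rw [filter_eq_empty_iff.2, card_empty, Nat.cast_zero]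
    intro v hv hne
    exact h0 (hdiag v (mem_filter.2 ⟨hv, hne⟩)).2.2.2.2

lemma card_sq_le_card_image_mul {ι M : Type*} [DecidableEq M] (s : Finset ι) (f : ι → M) :
    s.card ^ 2 ≤ (s.image f).card * ((s ×ˢ s).filter fun v => f v.1 = f v.2).card := by
  have h1 : s.card = ∑ b ∈ s.image f, (s.filter fun a => f a = b).card :=
    card_eq_sum_card_fiberwise fun a ha => mem_coe.2 (mem_image_of_mem f ha)
  have h2 : ((s ×ˢ s).filter fun v => f v.1 = f v.2).card =
      ∑ b ∈ s.image f, (s.filter fun a => f a = b).card ^ 2 := by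
    rw [card_eq_sum_card_fiberwise (f := fun v : ι × ι => f v.1) (t := s.image f)]
    · refine sum_congr rfl fun b _ => ?_
      rw [sq, ← card_product]
      congr 1
      ext ⟨u, v⟩
      simp only [mem_filter, mem_product]
      constructor
      · rintro ⟨⟨⟨hu, hv⟩, huv⟩, hb⟩
        exact ⟨⟨hu, hb⟩, hv, huv ▸ hb⟩
      · rintro ⟨⟨hu, hub⟩, hv, hvb⟩
        exact ⟨⟨⟨hu, hv⟩, hub.trans hvb.symm⟩, hub⟩
    · intro v hv
      exact mem_coe.2 (mem_image_of_mem f (mem_product.1 (mem_filter.1 hv).1).1)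
  rw [h2]
  nth_rewrite 1 [h1]
  exact_mod_cast sq_sum_le_card_mul_sum_sq (s := s.image f)
    (f := fun b => (s.filter fun a => f a = b).card)

/-- The value of `k` attached to `(y, x, i)`. -/
def shiftedValue (κ β A c : ℤ) (h : ℕ → ℤ) (v : ℤ × ℤ × ℕ) : ℤ :=
  v.1 + κ * v.1 ^ 2 - A * (v.2.1 + β * v.2.1 ^ 2 + h v.2.2) - c

lemma card_filter_shiftedValue_eq_le (κ β A c Y J Z : ℤ) (h : ℕ → ℤ) (T : ℕ) :
    (((Ioc Y (Y + J) ×ˢ Ioc Z (2 * Z) ×ˢ range T) ×ˢ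
      (Ioc Y (Y + J) ×ˢ Ioc Z (2 * Z) ×ˢ range T)).filter fun v =>
        shiftedValue κ β A c h v.1 = shiftedValue κ β A c h v.2).card ≤
      ∑ i ∈ range T, ∑ j ∈ range T, (collisions κ β A Y J Z (h i - h j)).card := by
  have key : (((Ioc Y (Y + J) ×ˢ Ioc Z (2 * Z) ×ˢ range T) ×ˢ
      (Ioc Y (Y + J) ×ˢ Ioc Z (2 * Z) ×ˢ range T)).filter fun v =>
        shiftedValue κ β A c h v.1 = shiftedValue κ β A c h v.2).card ≤
      ((range T).sigma fun i => (range T).sigma fun j =>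
        collisions κ β A Y J Z (h i - h j)).card := by
    apply card_le_card_of_injOn
      (fun v => ⟨v.1.2.2, v.2.2.2, (v.1.1, v.2.1, v.1.2.1, v.2.2.1)⟩)
    · rintro ⟨⟨y₁, x₁, i⟩, y₂, x₂, j⟩ hv
      simp only [coe_filter, mem_product, Set.mem_ofPred_eq] at hv
      obtain ⟨⟨⟨hy₁, hx₁, hi⟩, hy₂, hx₂, hj⟩, H⟩ := hv
      simp only [shiftedValue] at H
      simp only [coe_sigma, Set.mem_sigma_iff, mem_coe, collisions, mem_filter, mem_product]
      exact ⟨hi, hj, ⟨hy₁, hy₂, hx₁, hx₂⟩, by linear_combination H⟩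
    · rintro ⟨⟨y₁, x₁, i⟩, y₂, x₂, j⟩ - ⟨⟨y₁', x₁', i'⟩, y₂', x₂', j'⟩ - heq
      simp only [Sigma.mk.injEq] at heq
      obtain ⟨rfl, heq⟩ := heq
      simp only [heq_eq_eq, Sigma.mk.injEq] at heq
      obtain ⟨rfl, heq⟩ := heq
      simp only [Prod.mk.injEq] at heq
      obtain ⟨rfl, rfl, rfl, rfl⟩ := heq
      rfl
  simpa only [card_sigma] using key

/-- The divisors `l ≥ 2` of `h` that are coprime to `β`. -/
def coprimeDivisors (β h : ℤ) : Finset ℕ :=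
  h.natAbs.divisors.filter fun l => 2 ≤ l ∧ Nat.Coprime l β.natAbs

section Moments

variable {κ β A W q H : ℤ}

lemma exists_quotient_bound (hκ : 0 < κ) (hW : 0 < W) (hWβ : W = 2 * β) (hq : 4 * κ * W ^ 3 ≤ q)
    (hHq : H ≤ q) :
    ∃ E : ℤ, 0 ≤ E ∧ κ * W ^ 2 * E ≤ 2 * q ∧
      (1 + 4 * β * q) * q + H ≤ 2 * κ * (W ^ 3 * q) * E := by
  have hc : 0 < κ * W ^ 2 := by positivity
  have h1 := Int.ediv_mul_le (2 * q) hc.ne'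
  have h2 := Int.lt_ediv_add_one_mul_self (2 * q) hc
  have hq0 : 0 < q := lt_of_lt_of_le (by positivity) hq
  refine ⟨2 * q / (κ * W ^ 2), Int.ediv_nonneg (by lia) hc.le, by linarith, ?_⟩
  set E := 2 * q / (κ * W ^ 2)
  have h3 : 2 * q - κ * W ^ 2 ≤ κ * W ^ 2 * E := by linarith
  have h4 : (2 * q - κ * W ^ 2) * (2 * W * q) ≤ (κ * W ^ 2 * E) * (2 * W * q) := by gcongr
  have h5 : 4 * κ * W ^ 3 * q ≤ q * q := by gcongr
  have h6 : (1 : ℤ) ≤ W := hW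
  have h7 : 1 * (q * q) ≤ W * (q * q) := by gcongr
  have h8 : q * 4 ≤ q * q := by
    have : (0 : ℤ) < κ * W ^ 3 := by positivity
    gcongr
    lia
  have h9 : (1 + 4 * β * q) * q = q + 2 * W * (q * q) := by rw [hWβ]; ring
  rw [h9]
  nlinarith

lemma card_collisions_scaled_le {h : ℤ} (hκ : 0 < κ) (hW : 0 < W)
    (hWβ : W = 2 * β) (hA : A ≠ 0) (hκ2 : Even κ) (hβ2 : Even β)
    (hcA : ∀ m, IsCoprime (1 + κ * m) A) (hcβ : ∀ m, IsCoprime (1 + β * m) (2 * κ))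
    (hq : 4 * κ * W ^ 3 ≤ q) (hh : |h| * W ≤ q) (D : Finset ℕ) (hD0 : ∀ l ∈ D, 0 < l)
    (hD : ∀ l : ℕ, 2 ≤ l → (l : ℤ) ∣ h → IsCoprime (l : ℤ) β → (l : ℤ) ≤ q → l ∈ D) :
    ((collisions κ β A (W ^ 3 * q) (W ^ 2 * q) q h).card : ℝ) ≤
      (q ^ 2 / (2 * κ * W)) * (1 + 19 / W + 8 * ∑ l ∈ D, 1 / (l : ℝ) + 4 * D.card / q +
        (if h = 0 then (2 * κ * W ^ 3 : ℝ) else 0)) := by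
  have hq0 : 0 < q := lt_of_lt_of_le (by positivity) hq
  have hhq : |h| ≤ q := by nlinarith [abs_nonneg h]
  have hκ1 : (1 : ℤ) ≤ κ := hκ
  obtain ⟨E, hE0, hE1, hE2⟩ := exists_quotient_bound hκ hW hWβ hq hhq
  have hβ : 0 < β := by lia
  have hEq : E ≤ q := by
    have : (1 : ℤ) * 2 ^ 2 ≤ κ * W ^ 2 := by gcongr; lia
    nlinarith
  refine (card_collisions_le hκ hβ hA (by positivity) (by positivity) hq0 hκ2 hβ2 hcA hcβ hhq hE2 D
    hD0 fun l h1 h2 h3 h4 => hD l h1 h2 h3 (h4.trans hEq)).trans ?_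
  have hκR : (0 : ℝ) < κ := by exact_mod_cast hκ
  have hWR : (0 : ℝ) < W := by exact_mod_cast hW
  have hqR : (0 : ℝ) < q := by exact_mod_cast hq0
  have hβR : (β : ℝ) = W / 2 := by rw [hWβ]; push_cast; ring
  have hhR : |(h : ℝ)| * W ≤ q := by exact_mod_cast hh
  have hhqR : |(h : ℝ)| ≤ q := by exact_mod_cast hhq
  have hqR' : 4 * (κ : ℝ) * W ^ 3 ≤ q := by exact_mod_cast hq
  have hER : (κ : ℝ) * W ^ 2 * E ≤ 2 * q := by exact_mod_cast hE1
  push_cast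
  set X : ℝ := q ^ 2 / (2 * κ * W) with hX
  have hX0 : 0 < X := by positivity
  have hJ : (W : ℝ) ^ 2 * q / (2 * κ * (W ^ 3 * q)) = X / q ^ 2 := by rw [hX]; field_simp
  rw [hJ, hβR]
  have e1 : X / q ^ 2 * (q ^ 2 + 2 * q * |(h : ℝ)|) ≤ X * (1 + 2 / W) := by
    have : X / q ^ 2 * (q ^ 2 + 2 * q * |(h : ℝ)|) = X * (1 + 2 * (|(h : ℝ)| / q)) := by field_simp
    rw [this]
    have : |(h : ℝ)| / q ≤ 1 / W := by rw [div_le_div_iff₀ hqR hWR]; linarith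
    gcongr
    calc 2 * (|(h : ℝ)| / q) ≤ 2 * (1 / W) := by gcongr
      _ = 2 / W := by ring
  have e2 : (W : ℝ) ^ 2 * q / (W / 2) ≤ X * (1 / W) := by
    have : X * (1 / W) = q * q / (2 * κ * W ^ 2) := by rw [hX]; field_simp
    rw [this, le_div_iff₀ (by positivity)]
    calc (W : ℝ) ^ 2 * q / (W / 2) * (2 * κ * W ^ 2) = (q : ℝ) * (4 * κ * W ^ 3) := by
          field_simp
          ring
      _ ≤ (q : ℝ) * q := by gcongr
  have e3 : 4 * (q : ℝ) * E ≤ X * (16 / W) := by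
    have : X * (16 / W) = 4 * q * (2 * q) / (κ * W ^ 2) := by rw [hX]; field_simp; ring
    rw [this, le_div_iff₀ (by positivity)]
    calc 4 * (q : ℝ) * E * (κ * W ^ 2) = 4 * (q : ℝ) * (κ * W ^ 2 * E) := by ring
      _ ≤ 4 * (q : ℝ) * (2 * q) := by gcongr
  have e4 : ∑ l ∈ D, (2 * (q : ℝ) / (l : ℝ) + 1) * (2 * (X / q ^ 2) * (q + |(h : ℝ)|)) ≤
      X * (8 * ∑ l ∈ D, 1 / (l : ℝ) + 4 * D.card / q) := by
    calc ∑ l ∈ D, (2 * (q : ℝ) / (l : ℝ) + 1) * (2 * (X / q ^ 2) * (q + |(h : ℝ)|))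
        ≤ ∑ l ∈ D, (2 * (q : ℝ) / (l : ℝ) + 1) * (2 * (X / q ^ 2) * (q + q)) := by gcongr
      _ = ∑ l ∈ D, (8 * X * (1 / (l : ℝ)) + 4 * X / q) := by
          refine Finset.sum_congr rfl fun l _ => ?_
          field_simp
          ring
      _ = _ := by
          rw [Finset.sum_add_distrib, ← Finset.mul_sum]
          simp
          ring
  have e5 : (if h = 0 then ((W : ℝ) ^ 2 * q) * q else 0) =
      X * (if h = 0 then (2 * κ * W ^ 3 : ℝ) else 0) := by
    split_ifs
    · rw [hX]; field_simp
    · simp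
  rw [e5]
  calc _ ≤ X * (1 + 2 / W) + X * (1 / W) + X * (16 / W) +
      X * (8 * ∑ l ∈ D, 1 / (l : ℝ) + 4 * D.card / q) +
      X * (if h = 0 then (2 * κ * W ^ 3 : ℝ) else 0) := by gcongr
    _ = _ := by ring

end Moments

section SecondMoment

variable {κ β A W q c : ℤ} {h : ℕ → ℤ} {T : ℕ} {σ τ : ℝ}

lemma card_collisions_off_diagonal_le {h : ℤ} (hκ : 0 < κ) (hW : 0 < W)
    (hWβ : W = 2 * β) (hA : A ≠ 0) (hκ2 : Even κ) (hβ2 : Even β)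
    (hcA : ∀ m, IsCoprime (1 + κ * m) A) (hcβ : ∀ m, IsCoprime (1 + β * m) (2 * κ))
    (hq : 4 * κ * W ^ 3 ≤ q) (hh : |h| * W ≤ q) (hh0 : h ≠ 0)
    (hσ : ∑ l ∈ coprimeDivisors β h, 1 / (l : ℝ) ≤ σ) :
    ((collisions κ β A (W ^ 3 * q) (W ^ 2 * q) q h).card : ℝ) ≤
      (q ^ 2 / (2 * κ * W)) * (1 + 23 / W + 8 * σ) := by
  have hq0 : 0 < q := lt_of_lt_of_le (by positivity) hq
  have hκR : (0 : ℝ) < κ := by exact_mod_cast hκ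
  have hWR : (0 : ℝ) < W := by exact_mod_cast hW
  have hqR : (0 : ℝ) < q := by exact_mod_cast hq0
  refine (card_collisions_scaled_le hκ hW hWβ hA hκ2 hβ2 hcA hcβ hq hh (coprimeDivisors β h)
    (fun l hl => by simp only [coprimeDivisors, mem_filter] at hl; lia)
    fun l h1 h2 h3 _ => ?_).trans ?_
  · simp only [coprimeDivisors, mem_filter, Nat.mem_divisors]
    exact ⟨⟨Int.natCast_dvd.1 h2, Int.natAbs_ne_zero.2 hh0⟩, h1, by
      simpa [Int.gcd_def] using Int.isCoprime_iff_gcd_eq_one.1 h3⟩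
  · rw [if_neg hh0]
    have hcard : ((coprimeDivisors β h).card : ℝ) ≤ |(h : ℝ)| := by
      have : (coprimeDivisors β h).card ≤ h.natAbs :=
        (card_filter_le _ _).trans (Nat.card_divisors_le_self _)
      have h2 : ((h.natAbs : ℕ) : ℝ) = |(h : ℝ)| := by
        rw [← Int.cast_abs, Int.abs_eq_natAbs]; simp
      rw [← h2]
      exact_mod_cast this
    have hhR : |(h : ℝ)| * W ≤ q := by exact_mod_cast hh
    have : 4 * ((coprimeDivisors β h).card : ℝ) / q ≤ 4 / W := by
      rw [div_le_div_iff₀ hqR hWR]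
      nlinarith
    have e : (19 : ℝ) / W + 4 / W = 23 / W := by ring
    refine mul_le_mul_of_nonneg_left ?_ (by positivity)
    linarith

lemma card_collisions_diagonal_le (hκ : 0 < κ) (hW : 0 < W)
    (hWβ : W = 2 * β) (hA : A ≠ 0) (hκ2 : Even κ) (hβ2 : Even β)
    (hcA : ∀ m, IsCoprime (1 + κ * m) A) (hcβ : ∀ m, IsCoprime (1 + β * m) (2 * κ))
    (hq : 4 * κ * W ^ 3 ≤ q) (hτ : ∑ l ∈ Icc 1 q.toNat, 1 / (l : ℝ) ≤ τ)
    (hT : (24 + 8 * τ + 2 * κ * W ^ 3) * W ≤ T) :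
    ((collisions κ β A (W ^ 3 * q) (W ^ 2 * q) q 0).card : ℝ) ≤
      (q ^ 2 / (2 * κ * W)) * (T / W) := by
  have hq0 : 0 < q := lt_of_lt_of_le (by positivity) hq
  have hκR : (0 : ℝ) < κ := by exact_mod_cast hκ
  have hWR : (0 : ℝ) < W := by exact_mod_cast hW
  have hW1 : (1 : ℝ) ≤ W := by exact_mod_cast hW
  have hqR : (0 : ℝ) < q := by exact_mod_cast hq0
  refine (card_collisions_scaled_le hκ hW hWβ hA hκ2 hβ2 hcA hcβ hq (by simpa using hq0.le)
    (Icc 1 q.toNat) (fun l hl => by simp at hl; lia)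
    fun l h1 h2 h3 h4 => by simp; lia).trans ?_
  rw [if_pos rfl]
  have e : 4 * ((Icc 1 q.toNat).card : ℝ) / q = 4 := by
    have : ((q.toNat : ℤ) : ℝ) = q := by rw [Int.toNat_of_nonneg hq0.le]
    rw [Nat.card_Icc, Nat.add_sub_cancel, ← this]
    push_cast at this ⊢
    rw [this]; field_simp
  have e2 : (19 : ℝ) / W ≤ 19 := div_le_self (by norm_num) hW1
  rw [e]
  gcongr
  rw [le_div_iff₀ hWR]
  refine le_trans ?_ hT
  refine mul_le_mul_of_nonneg_right ?_ hWR.le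
  linarith

theorem mul_sq_le_card_image_shiftedValue (hκ : 0 < κ) (hW : 0 < W)
    (hWβ : W = 2 * β) (hA : A ≠ 0) (hκ2 : Even κ) (hβ2 : Even β)
    (hcA : ∀ m, IsCoprime (1 + κ * m) A) (hcβ : ∀ m, IsCoprime (1 + β * m) (2 * κ))
    (hq : 4 * κ * W ^ 3 ≤ q) (hσ0 : 0 ≤ σ)
    (hh : ∀ i < T, ∀ j < T, |h i - h j| * W ≤ q)
    (hinj : ∀ i < T, ∀ j < T, i ≠ j → h i - h j ≠ 0)
    (hσ : ∀ i < T, ∀ j < T, i ≠ j → ∑ l ∈ coprimeDivisors β (h i - h j), 1 / (l : ℝ) ≤ σ)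
    (hτ : ∑ l ∈ Icc 1 q.toNat, 1 / (l : ℝ) ≤ τ)
    (hT0 : 0 < T) (hT : (24 + 8 * τ + 2 * κ * W ^ 3) * W ≤ T) :
    2 * κ * W ^ 5 * q ^ 2 ≤ (((Ioc (W ^ 3 * q) (W ^ 3 * q + W ^ 2 * q) ×ˢ Ioc q (2 * q) ×ˢ
      range T).image (shiftedValue κ β A c h)).card : ℝ) * (1 + 24 / W + 8 * σ) := by
  have hq0 : 0 < q := lt_of_lt_of_le (by positivity) hq
  have hκR : (0 : ℝ) < κ := by exact_mod_cast hκ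
  have hWR : (0 : ℝ) < W := by exact_mod_cast hW
  have hqR : (0 : ℝ) < q := by exact_mod_cast hq0
  have hTR : (0 : ℝ) < T := by exact_mod_cast hT0
  set X : ℝ := q ^ 2 / (2 * κ * W) with hX
  have hX0 : 0 < X := by positivity
  set s := Ioc (W ^ 3 * q) (W ^ 3 * q + W ^ 2 * q) ×ˢ Ioc q (2 * q) ×ˢ range T with hs
  have hpairs : (∑ i ∈ range T, ∑ j ∈ range T,
      ((collisions κ β A (W ^ 3 * q) (W ^ 2 * q) q (h i - h j)).card : ℝ)) ≤
      T ^ 2 * X * (1 + 24 / W + 8 * σ) := by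
    have hrow : ∀ i ∈ range T, ∑ j ∈ range T,
        ((collisions κ β A (W ^ 3 * q) (W ^ 2 * q) q (h i - h j)).card : ℝ) ≤
        T * X * (1 + 24 / W + 8 * σ) := by
      intro i hi
      have hterm : ∀ j ∈ range T,
          ((collisions κ β A (W ^ 3 * q) (W ^ 2 * q) q (h i - h j)).card : ℝ) ≤
          X * (1 + 23 / W + 8 * σ) + if j = i then X * (T / W) else 0 := by
        intro j hj
        rw [mem_range] at hi hj
        split_ifs with hij
        · subst hij
          rw [sub_self]
          have := card_collisions_diagonal_le hκ hW hWβ hA hκ2 hβ2 hcA hcβ hq hτ hT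
          have h0 : 0 ≤ X * (1 + 23 / W + 8 * σ) := by positivity
          linarith
        · rw [add_zero]
          exact card_collisions_off_diagonal_le hκ hW hWβ hA hκ2 hβ2 hcA hcβ hq (hh i hi j hj)
            (hinj i hi j hj (Ne.symm hij)) (hσ i hi j hj (Ne.symm hij))
      refine (sum_le_sum hterm).trans ?_
      rw [sum_add_distrib, sum_const, card_range, sum_ite_eq', if_pos hi, nsmul_eq_mul]
      apply le_of_eq
      ring
    refine (sum_le_sum hrow).trans ?_
    rw [sum_const, card_range, nsmul_eq_mul]
    apply le_of_eq
    ring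
  have hcs := card_sq_le_card_image_mul s (shiftedValue κ β A c h)
  have hle := card_filter_shiftedValue_eq_le κ β A c (W ^ 3 * q) (W ^ 2 * q) q h T
  have hcard : (s.card : ℝ) = W ^ 2 * q * q * T := by
    have h1 : ((W ^ 2 * q).toNat : ℤ) = W ^ 2 * q := Int.toNat_of_nonneg (by positivity)
    have h2 : (q.toNat : ℤ) = q := Int.toNat_of_nonneg hq0.le
    have h3 : (s.card : ℤ) = W ^ 2 * q * q * T := by
      rw [hs, card_product, card_product, Int.card_Ioc, Int.card_Ioc, card_range,
        add_sub_cancel_left, show 2 * q - q = q by ring]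
      push_cast [h1, h2]
      ring
    exact_mod_cast h3
  set I := ((s.image (shiftedValue κ β A c h)).card : ℝ) with hI
  have hcsR : (s.card : ℝ) ^ 2 ≤ I * (T ^ 2 * X * (1 + 24 / W + 8 * σ)) := by
    refine le_trans ?_ (mul_le_mul_of_nonneg_left hpairs (Nat.cast_nonneg _))
    rw [hI]
    exact_mod_cast hcs.trans (Nat.mul_le_mul_left _ hle)
  rw [hcard, hX] at hcsR
  have e1 : ((W : ℝ) ^ 2 * q * q * T) ^ 2 =
      (T ^ 2 * q ^ 2 / (2 * κ * W)) * (2 * κ * W ^ 5 * q ^ 2) := by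
    field_simp
  have e2 : I * ((T : ℝ) ^ 2 * (q ^ 2 / (2 * κ * W)) * (1 + 24 / W + 8 * σ)) =
      (T ^ 2 * q ^ 2 / (2 * κ * W)) * (I * (1 + 24 / W + 8 * σ)) := by ring
  rw [e1, e2] at hcsR
  exact le_of_mul_le_mul_left hcsR (by positivity)

end SecondMoment

section RoughDivisors

lemma exists_sum_coprime_divisors_le {b w : ℕ} (hw : 0 < w)
    (hb : ∀ p : ℕ, p.Prime → p ≤ w → p ∣ b) (h : ℕ) (hh : h ≠ 0) :
    ∃ n : ℕ, w ^ n ≤ h ∧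
      ∑ l ∈ h.divisors.filter (fun l => l.Coprime b), 1 / (l : ℝ) ≤ (1 + 1 / (w : ℝ)) ^ n := by
  have hwR : (0 : ℝ) < w := by exact_mod_cast hw
  induction h using induction_on_primes with
  | zero => exact absurd rfl hh
  | one => exact ⟨0, by simp, by simp [filter_singleton]⟩
  | prime_mul p m hp ih =>
    have hm : m ≠ 0 := right_ne_zero_of_mul hh
    obtain ⟨n, hn, hs⟩ := ih hm
    by_cases hpb : p ∣ b
    · refine ⟨n, hn.trans (Nat.le_mul_of_pos_left _ hp.pos), le_trans ?_ hs⟩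
      refine sum_le_sum_of_subset_of_nonneg (fun l hl => ?_) fun _ _ _ => by positivity
      simp only [mem_filter, Nat.mem_divisors] at hl ⊢
      refine ⟨⟨?_, hm⟩, hl.2⟩
      exact (Nat.Coprime.coprime_dvd_right hpb hl.2).dvd_of_dvd_mul_left hl.1.1
    · have hpw : w < p := by
        by_contra hlt
        exact hpb (hb p hp (not_lt.1 hlt))
      refine ⟨n + 1, ?_, ?_⟩
      · rw [pow_succ, mul_comm p m]
        exact Nat.mul_le_mul hn hpw.le
      · set F := m.divisors.filter fun l => l.Coprime b with hF
        have hsub : (p * m).divisors.filter (fun l => l.Coprime b) ⊆ F ∪ F.image (p * ·) := by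
          intro l hl
          simp only [mem_filter, Nat.mem_divisors] at hl
          simp only [hF, mem_union, mem_image, mem_filter, Nat.mem_divisors]
          by_cases hpl : p ∣ l
          · obtain ⟨e, rfl⟩ := hpl
            exact Or.inr ⟨e, ⟨⟨Nat.dvd_of_mul_dvd_mul_left hp.pos hl.1.1, hm⟩,
              Nat.Coprime.coprime_dvd_left (dvd_mul_left _ _) hl.2⟩, rfl⟩
          · refine Or.inl ⟨⟨?_, hm⟩, hl.2⟩
            exact (((Nat.Prime.coprime_iff_not_dvd hp).2 hpl).symm).dvd_of_dvd_mul_left hl.1.1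
        have himage : ∑ l ∈ F.image (p * ·), 1 / (l : ℝ) = (1 / p) * ∑ l ∈ F, 1 / (l : ℝ) := by
          rw [sum_image fun x _ y _ hxy => Nat.eq_of_mul_eq_mul_left hp.pos hxy, mul_sum]
          refine sum_congr rfl fun l _ => ?_
          push_cast
          rw [one_div_mul_one_div]
        have hnonneg : 0 ≤ ∑ l ∈ F, 1 / (l : ℝ) := sum_nonneg fun _ _ => by positivity
        calc _ ≤ ∑ l ∈ F ∪ F.image (p * ·), 1 / (l : ℝ) :=
              sum_le_sum_of_subset_of_nonneg hsub fun _ _ _ => by positivity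
          _ ≤ ∑ l ∈ F, 1 / (l : ℝ) + ∑ l ∈ F.image (p * ·), 1 / (l : ℝ) := by
              rw [← sum_union_inter]
              exact le_add_of_nonneg_right (sum_nonneg fun _ _ => by positivity)
          _ = (1 + 1 / (p : ℝ)) * ∑ l ∈ F, 1 / (l : ℝ) := by rw [himage]; ring
          _ ≤ (1 + 1 / (w : ℝ)) * (1 + 1 / (w : ℝ)) ^ n := by gcongr
          _ = _ := by ring

lemma sum_coprimeDivisors_le {β h : ℤ} {w c m : ℕ} (hc : 2 ≤ c) (hm : 0 < m) (hwc : c ^ m ≤ w)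
    (hβ : ∀ p : ℕ, p.Prime → p ≤ w → (p : ℤ) ∣ β) (hh : h ≠ 0) (hhc : |h| ≤ (c : ℤ) ^ w) :
    ∑ l ∈ coprimeDivisors β h, 1 / (l : ℝ) ≤ 2 / m := by
  have hw : 0 < w := lt_of_lt_of_le (by positivity) hwc
  have hwR : (0 : ℝ) < w := by exact_mod_cast hw
  have hmR : (0 : ℝ) < m := by exact_mod_cast hm
  obtain ⟨n, hn, hs⟩ := exists_sum_coprime_divisors_le hw
    (fun p hp hpw => Int.natCast_dvd.1 (hβ p hp hpw)) h.natAbs (Int.natAbs_ne_zero.2 hh)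
  have hnm : m * n ≤ w := by
    have h1 : h.natAbs ≤ c ^ w := by zify; exact hhc
    have h2 : c ^ (m * n) ≤ c ^ w := by
      rw [pow_mul]
      exact (Nat.pow_le_pow_left hwc n).trans (hn.trans h1)
    exact (Nat.pow_le_pow_iff_right hc).1 h2
  have hsplit : ∑ l ∈ coprimeDivisors β h, 1 / (l : ℝ) + 1 ≤
      ∑ l ∈ h.natAbs.divisors.filter (fun l => l.Coprime β.natAbs), 1 / (l : ℝ) := by
    have h1 : (1 : ℕ) ∉ coprimeDivisors β h := by simp [coprimeDivisors]
    have : ∑ l ∈ insert 1 (coprimeDivisors β h), 1 / (l : ℝ) =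
        1 + ∑ l ∈ coprimeDivisors β h, 1 / (l : ℝ) := by rw [sum_insert h1]; simp
    rw [add_comm, ← this]
    refine sum_le_sum_of_subset_of_nonneg (fun l hl => ?_) fun _ _ _ => by positivity
    simp only [coprimeDivisors, mem_insert, mem_filter, Nat.mem_divisors] at hl ⊢
    rcases hl with rfl | hl
    · simpa using hh
    · exact ⟨hl.1, hl.2.2⟩
  have hexp : (1 + 1 / (w : ℝ)) ^ n ≤ 1 + 2 / m := by
    have h1 : (1 + 1 / (w : ℝ)) ^ n ≤ Real.exp (1 / m) := by
      calc (1 + 1 / (w : ℝ)) ^ n ≤ Real.exp (1 / w) ^ n := by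
            gcongr
            rw [add_comm]
            exact Real.add_one_le_exp _
        _ = Real.exp (n * (1 / w)) := (Real.exp_nat_mul _ _).symm
        _ ≤ Real.exp (1 / m) := by
            gcongr
            rw [mul_one_div, div_le_div_iff₀ hwR hmR]
            have : ((m * n : ℕ) : ℝ) ≤ w := by exact_mod_cast hnm
            push_cast at this
            linarith
    have h2 : |1 / (m : ℝ)| ≤ 1 := by
      rw [abs_of_pos (by positivity), div_le_one hmR]
      exact_mod_cast hm
    have h3 := (abs_le.1 (Real.abs_exp_sub_one_le h2)).2
    rw [abs_of_pos (by positivity)] at h3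
    have : 2 * (1 / (m : ℝ)) = 2 / m := by ring
    linarith
  linarith

end RoughDivisors

/-- The arithmetic data attached to an even modulus `V` divisible by all primes dividing `a`. -/
structure FibreData (a : ℤ) (r : ℕ) (V W K κ β A : ℤ) (T : ℕ) : Prop where
  a_ne : a ≠ 0
  two_le_r : 2 ≤ r
  V_pos : 0 < V
  V_even : 2 ∣ V
  dvd_V : ∀ p : ℤ, Prime p → p ∣ a → p ∣ V
  two_a_le : 2 * |a| ≤ V
  W_eq : W = V ^ 2
  K_eq : K = V ^ (2 * r)
  K_eq_κ : K = 4 * κ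
  W_eq_β : W = 2 * β
  A_eq : A = 2 * a * K * W
  T_eq : (T : ℤ) = V ^ (2 * r + 8)

/-- The `i`-th numerator of `t`. -/
def numer (K A : ℤ) (i : ℕ) : ℤ := 1 + K * A ^ 2 * i

/-- The shift `(numer K A i ^ r - 1) / (K * A)`. -/
def numerShift (r : ℕ) (K A : ℤ) (i : ℕ) : ℤ := A * i * ∑ j ∈ range r, numer K A i ^ j

lemma mul_numerShift (r : ℕ) (K A : ℤ) (i : ℕ) :
    K * A * numerShift r K A i = numer K A i ^ r - 1 := by
  rw [← geom_sum_mul, numerShift, show numer K A i - 1 = K * A * (A * i) by rw [numer]; ring]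
  ring

lemma isCoprime_one_add_mul {x y m : ℤ} (hy : y ≠ 0) (h : ∀ p : ℤ, Prime p → p ∣ y → p ∣ x) :
    IsCoprime (1 + x * m) y := by
  refine isCoprime_of_prime_dvd (fun h0 => hy h0.2) fun p hp h1 h2 => ?_
  have h3 : p ∣ x * m := (h p hp h2).mul_right m
  exact hp.not_isUnit (isUnit_of_dvd_one ((dvd_add_left h3).1 h1))

namespace FibreData

variable {a : ℤ} {r : ℕ} {V W K κ β A : ℤ} {T : ℕ}

lemma W_pos (d : FibreData a r V W K κ β A T) : 0 < W := by have := d.V_pos; rw [d.W_eq]; positivity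

lemma K_pos (d : FibreData a r V W K κ β A T) : 0 < K := by have := d.V_pos; rw [d.K_eq]; positivity

lemma κ_pos (d : FibreData a r V W K κ β A T) : 0 < κ := by have := d.K_pos; have := d.K_eq_κ; lia

lemma A_ne (d : FibreData a r V W K κ β A T) : A ≠ 0 := by
  rw [d.A_eq]
  have := d.a_ne
  have := d.W_pos.ne'
  have := d.K_pos.ne'
  positivity

lemma V_dvd_κ (d : FibreData a r V W K κ β A T) : V ∣ κ := by
  obtain ⟨v, hv⟩ := d.V_even
  obtain ⟨s, hs⟩ := Nat.exists_eq_add_of_le d.two_le_r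
  have h : 4 * κ = 4 * (V * (V ^ (1 + 2 * s) * v ^ 2)) := by
    rw [← d.K_eq_κ, d.K_eq, hs, show 2 * (2 + s) = 2 + (1 + 2 * s) + 1 by ring]
    have : V ^ 2 = 4 * v ^ 2 := by rw [hv]; ring
    rw [pow_succ, pow_add, this]
    ring
  exact ⟨_, mul_left_cancel₀ (by norm_num) h⟩

lemma V_dvd_β (d : FibreData a r V W K κ β A T) : V ∣ β := by
  obtain ⟨v, hv⟩ := d.V_even
  have h : 2 * β = 2 * (V * v) := by
    rw [← d.W_eq_β, d.W_eq, sq]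
    nth_rewrite 2 [hv]
    ring
  exact ⟨_, mul_left_cancel₀ (by norm_num) h⟩

lemma even_κ (d : FibreData a r V W K κ β A T)
    : Even κ := even_iff_two_dvd.2 (d.V_even.trans d.V_dvd_κ)

lemma even_β (d : FibreData a r V W K κ β A T)
    : Even β := even_iff_two_dvd.2 (d.V_even.trans d.V_dvd_β)

lemma isCoprime_A (d : FibreData a r V W K κ β A T) (m : ℤ) : IsCoprime (1 + κ * m) A := by
  refine isCoprime_one_add_mul d.A_ne fun p hp h => ?_
  refine dvd_trans ?_ d.V_dvd_κ
  rw [d.A_eq, d.K_eq, d.W_eq] at h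
  rcases hp.dvd_or_dvd h with h | h
  · rcases hp.dvd_or_dvd h with h | h
    · rcases hp.dvd_or_dvd h with h | h
      · exact h.trans d.V_even
      · exact d.dvd_V p hp h
    · exact hp.dvd_of_dvd_pow h
  · exact hp.dvd_of_dvd_pow h

lemma isCoprime_two_mul_κ (d : FibreData a r V W K κ β A T)
    (m : ℤ) : IsCoprime (1 + β * m) (2 * κ) := by
  refine isCoprime_one_add_mul (mul_ne_zero two_ne_zero d.κ_pos.ne') fun p hp h => ?_
  refine dvd_trans ?_ d.V_dvd_β
  have h2 : p ∣ V ^ (2 * r) := by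
    rw [← d.K_eq, d.K_eq_κ, show 4 * κ = 2 * κ * 2 by ring]
    exact h.mul_right 2
  exact hp.dvd_of_dvd_pow h2

lemma V_ge (d : FibreData a r V W K κ β A T) : 2 ≤ V := Int.le_of_dvd d.V_pos d.V_even

lemma T_pos (d : FibreData a r V W K κ β A T) : 0 < T := by
  have : (0 : ℤ) < T := by have := d.V_pos; rw [d.T_eq]; positivity
  exact_mod_cast this

lemma abs_A (d : FibreData a r V W K κ β A T) : |A| = 8 * |a| * W * κ := by
  rw [d.A_eq, d.K_eq_κ]
  simp only [abs_mul, abs_of_pos d.W_pos, abs_of_pos d.κ_pos]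
  norm_num
  ring

lemma abs_A_le (d : FibreData a r V W K κ β A T) : |A| ≤ V ^ (2 * r + 3) := by
  have h1 : |A| = 2 * |a| * (V ^ (2 * r) * V ^ 2) := by
    rw [d.A_eq, abs_mul, abs_mul, abs_mul, abs_of_pos d.W_pos, abs_of_pos d.K_pos, d.K_eq, d.W_eq]
    norm_num
    ring
  rw [h1]
  have := d.V_pos
  calc 2 * |a| * (V ^ (2 * r) * V ^ 2) ≤ V * (V ^ (2 * r) * V ^ 2) := by
        have := d.two_a_le
        gcongr
    _ = _ := by ring

lemma numer_pos (d : FibreData a r V W K κ β A T) (i : ℕ) : 0 < numer K A i := by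
  have := d.K_pos
  rw [numer]
  positivity

lemma numer_lt (d : FibreData a r V W K κ β A T)
    {i j : ℕ} (hij : i < j) : numer K A i < numer K A j := by
  have h1 := d.K_pos
  have h2 := d.A_ne
  have h3 : 0 < K * A ^ 2 := by positivity
  rw [numer, numer]
  have : (i : ℤ) < j := by exact_mod_cast hij
  have := mul_lt_mul_of_pos_left this h3
  lia

lemma numer_pow_le (d : FibreData a r V W K κ β A T)
    {i : ℕ} (hi : i < T) : numer K A i ^ r ≤ V ^ (r * (8 * r + 14)) := by
  have hV := d.V_pos
  have h3 : (1 : ℤ) ≤ K * A ^ 2 := by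
    have h1 := d.K_pos
    have h2 := d.A_ne
    have : 0 < K * A ^ 2 := by positivity
    lia
  have h4 : numer K A i ≤ V ^ (8 * r + 14) := by
    have h5 : (i : ℤ) + 1 ≤ T := by exact_mod_cast hi
    calc numer K A i ≤ K * A ^ 2 * (i + 1) := by rw [numer]; linarith
      _ ≤ K * A ^ 2 * T := by gcongr
      _ = K * |A| ^ 2 * T := by rw [sq_abs]
      _ ≤ V ^ (2 * r) * (V ^ (2 * r + 3)) ^ 2 * V ^ (2 * r + 8) := by
          have := d.abs_A_le
          rw [d.T_eq, d.K_eq]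
          gcongr
      _ = _ := by ring
  calc numer K A i ^ r ≤ (V ^ (8 * r + 14)) ^ r := pow_le_pow_left₀ (d.numer_pos i).le h4 r
    _ = _ := by rw [← pow_mul, mul_comm]

lemma one_le_abs_mul (d : FibreData a r V W K κ β A T) : 1 ≤ |K * A| :=
  Int.one_le_abs (mul_ne_zero d.K_pos.ne' d.A_ne)

lemma abs_numerShift_sub_le (d : FibreData a r V W K κ β A T) {i j : ℕ} (hi : i < T) (hj : j < T) :
    |numerShift r K A i - numerShift r K A j| ≤ V ^ (r * (8 * r + 14)) := by
  have h1 : |K * A| * |numerShift r K A i - numerShift r K A j| =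
      |numer K A i ^ r - numer K A j ^ r| := by
    rw [← abs_mul, mul_sub, mul_numerShift, mul_numerShift]
    congr 1
    ring
  have h2 := d.one_le_abs_mul
  have h3 : |numer K A i ^ r - numer K A j ^ r| ≤ V ^ (r * (8 * r + 14)) := by
    have := d.numer_pow_le hi
    have := d.numer_pow_le hj
    have := pow_pos (d.numer_pos i) r
    have := pow_pos (d.numer_pos j) r
    rw [abs_le]
    constructor <;> lia
  have := abs_nonneg (numerShift r K A i - numerShift r K A j)
  nlinarith

lemma abs_numerShift_le (d : FibreData a r V W K κ β A T) {i : ℕ} (hi : i < T) :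
    |numerShift r K A i| ≤ V ^ (r * (8 * r + 14)) := by
  simpa [numerShift] using d.abs_numerShift_sub_le hi d.T_pos

lemma numerShift_sub_ne (d : FibreData a r V W K κ β A T) {i j : ℕ} (hij : i ≠ j) :
    numerShift r K A i - numerShift r K A j ≠ 0 := by
  intro h
  have h1 : numer K A i ^ r = numer K A j ^ r := by
    have h2 := mul_numerShift r K A i
    have h3 := mul_numerShift r K A j
    rw [sub_eq_zero.1 h] at h2
    linarith
  have hr : r ≠ 0 := by have := d.two_le_r; lia
  rcases lt_or_gt_of_ne hij with hlt | hlt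
  · exact (pow_lt_pow_left₀ (d.numer_lt hlt) (d.numer_pos i).le hr).ne h1
  · exact (pow_lt_pow_left₀ (d.numer_lt hlt) (d.numer_pos j).le hr).ne h1.symm

/-- Every value of `shiftedValue` comes with a rational point. -/
lemma exists_rational_point (d : FibreData a r V W K κ β A T) {k : ℤ} {v : ℤ × ℤ × ℕ}
    (hk : k = shiftedValue κ β A (a * K) (numerShift r K A) v) :
    ∃ y z t : ℚ, y ^ 2 - a * z ^ 2 = t ^ r + k ∧ t ^ r + (k : ℚ) ≠ 0 := by
  obtain ⟨y, x, i⟩ := v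
  have hmain : (1 + 2 * κ * y) ^ 2 - a * (K * (1 + W * x)) ^ 2 = numer K A i ^ r + K * k := by
    have h1 := mul_numerShift r K A i
    have hKκ := d.K_eq_κ
    have hWβ := d.W_eq_β
    have hA := d.A_eq
    rw [hk, shiftedValue]
    simp only
    have : numer K A i ^ r = 1 + K * A * numerShift r K A i := by linarith
    rw [this]
    generalize numerShift r K A i = s
    subst hWβ hA hKκ
    ring
  have hne : numer K A i ^ r + K * k ≠ 0 := by
    intro h0
    have h1 := mul_numerShift r K A i
    have h2 : K ∣ 1 := ⟨-(A * numerShift r K A i + k), by linarith⟩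
    have h3 : K = 1 := Int.eq_one_of_dvd_one d.K_pos.le h2
    have := d.K_eq_κ
    lia
  have hV : (V : ℚ) ≠ 0 := by exact_mod_cast d.V_pos.ne'
  have hVK : (K : ℚ) = V ^ (2 * r) := by exact_mod_cast d.K_eq
  have hmainQ : ((1 : ℚ) + 2 * κ * y) ^ 2 - a * (K * (1 + W * x)) ^ 2 =
      (numer K A i : ℚ) ^ r + K * k := by exact_mod_cast hmain
  have hneQ : (numer K A i : ℚ) ^ r + K * k ≠ 0 := by exact_mod_cast hne
  have ht : ((numer K A i : ℚ) / V ^ 2) ^ r + k =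
      ((numer K A i : ℚ) ^ r + K * k) / V ^ (2 * r) := by
    rw [div_pow, ← pow_mul, hVK]
    field_simp
  refine ⟨(1 + 2 * κ * y) / V ^ r, K * (1 + W * x) / V ^ r, numer K A i / V ^ 2, ?_, ?_⟩
  · rw [ht, ← hmainQ, div_pow, div_pow, ← pow_mul, mul_comm r 2]
    field_simp
  · rw [ht]
    exact div_ne_zero hneQ (pow_ne_zero _ hV)

end FibreData

/-- A bound for the part of `shiftedValue` that does not depend on the first coordinate. -/
def spread (a K β A H q : ℤ) : ℤ := |A| * (2 * q + 4 * β * q ^ 2 + H) + |a| * K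

/-- An upper bound for the values of `shiftedValue` at scale `q`. -/
def topValue (a K κ β A W H q : ℤ) : ℤ :=
  (W ^ 3 * q + W ^ 2 * q) + κ * (W ^ 3 * q + W ^ 2 * q) ^ 2 + spread a K β A H q

namespace FibreData

variable {a : ℤ} {r : ℕ} {V W K κ β A : ℤ} {T : ℕ}

lemma shiftedValue_mem (d : FibreData a r V W K κ β A T)
    {q H : ℤ} (hq : 0 ≤ q) (hH : ∀ i < T, |numerShift r K A i| ≤ H)
    {v : ℤ × ℤ × ℕ}
    (hv : v ∈ Ioc (W ^ 3 * q) (W ^ 3 * q + W ^ 2 * q) ×ˢ Ioc q (2 * q) ×ˢ range T) :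
    shiftedValue κ β A (a * K) (numerShift r K A) v ∈
      Ioc (κ * (W ^ 3 * q) ^ 2 - spread a K β A H q) (topValue a K κ β A W H q) := by
  obtain ⟨y, x, i⟩ := v
  simp only [mem_product, mem_Ioc, mem_range] at hv
  obtain ⟨⟨hy1, hy2⟩, ⟨hx1, hx2⟩, hi⟩ := hv
  have hκ := d.κ_pos
  have hW := d.W_pos
  have hβ : 0 < β := by have := d.W_eq_β; lia
  have hY : 0 ≤ W ^ 3 * q := by positivity
  have hx0 : 0 ≤ x := hq.trans hx1.le
  have hy0 : 0 ≤ y := hY.trans hy1.le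
  have h1 : |A * (x + β * x ^ 2 + numerShift r K A i) + a * K| ≤ spread a K β A H q := by
    refine (abs_add_le _ _).trans ?_
    rw [abs_mul, abs_mul a, abs_of_pos d.K_pos, spread]
    gcongr
    refine (abs_add_le _ _).trans ?_
    rw [abs_of_nonneg (by positivity : 0 ≤ x + β * x ^ 2)]
    have h2 : β * x ^ 2 ≤ β * (2 * q) ^ 2 := by gcongr
    have := hH i hi
    linarith
  have h2 := abs_le.1 h1
  have h3 : κ * (W ^ 3 * q) ^ 2 ≤ κ * y ^ 2 := by gcongr
  have h4 : κ * y ^ 2 ≤ κ * (W ^ 3 * q + W ^ 2 * q) ^ 2 := by gcongr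
  simp only [shiftedValue, mem_Ioc, topValue]
  constructor <;> linarith

lemma spread_le (d : FibreData a r V W K κ β A T) {H q : ℤ} (hq : 1 ≤ q) (hH : H ≤ q) :
    spread a K β A H q ≤ 24 * (V * W ^ 2 * κ * q ^ 2) := by
  have hκ := d.κ_pos
  have hW : 1 ≤ W := d.W_pos
  have hV := d.V_pos
  have h1 : |A| ≤ 4 * V * W * κ := by
    rw [d.abs_A]
    have := mul_le_mul_of_nonneg_right d.two_a_le (by positivity : 0 ≤ 4 * (W * κ))
    linarith
  have h2 : |a| * K ≤ |A| * q := by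
    have e : |A| = |a| * K * (2 * W) := by rw [d.abs_A, d.K_eq_κ]; ring
    have hK := d.K_pos
    rw [e, mul_assoc]
    refine le_mul_of_one_le_right (by positivity) ?_
    nlinarith
  have h3 : q ≤ W * q ^ 2 := by
    have : 1 * (1 * q) ≤ W * (q * q) := by gcongr
    linarith
  calc spread a K β A H q = |A| * (2 * q + 2 * W * q ^ 2 + H) + |a| * K := by
        rw [spread, d.W_eq_β]; ring
    _ ≤ |A| * (2 * q + 2 * W * q ^ 2 + q) + |A| * q := by gcongr
    _ = |A| * (4 * q + 2 * W * q ^ 2) := by ring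
    _ ≤ (4 * V * W * κ) * (6 * (W * q ^ 2)) := by gcongr; linarith
    _ = _ := by ring

lemma V_le_W (d : FibreData a r V W K κ β A T) : V ≤ W := by
  rw [d.W_eq, sq]
  have := d.V_ge
  nlinarith

lemma spread_le_main (d : FibreData a r V W K κ β A T) {H q : ℤ} (hq : 1 ≤ q) (hH : H ≤ q) :
    spread a K β A H q ≤ 24 * (κ * W ^ 4 * q ^ 2) := by
  have hκ := d.κ_pos
  have hW : 1 ≤ W := d.W_pos
  refine (d.spread_le hq hH).trans ?_
  calc 24 * (V * W ^ 2 * κ * q ^ 2) ≤ 24 * (W * W ^ 2 * κ * q ^ 2) := by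
        have := d.V_le_W
        gcongr
    _ = 24 * (κ * (W ^ 3 * 1) * q ^ 2) := by ring
    _ ≤ 24 * (κ * (W ^ 3 * W) * q ^ 2) := by gcongr
    _ = _ := by ring

lemma window_length_le (d : FibreData a r V W K κ β A T) {H q : ℤ} (hq : W ^ 2 ≤ q) (hH : H ≤ q) :
    topValue a K κ β A W H (q + 1) - (κ * (W ^ 3 * q) ^ 2 - spread a K β A H q) ≤
      2 * (κ * W ^ 5 * q ^ 2) + 140 * (κ * W ^ 4 * q ^ 2) := by
  have hκ : 1 ≤ κ := d.κ_pos
  have hW : 1 ≤ W := d.W_pos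
  have hq1 : 1 ≤ q := le_trans (by nlinarith) hq
  have h1 := d.spread_le_main hq1 hH
  have h2 := d.spread_le_main (by lia : 1 ≤ q + 1) (by lia : H ≤ q + 1)
  have h3 : 24 * (κ * W ^ 4 * (q + 1) ^ 2) ≤ 24 * (κ * W ^ 4 * (q + q) ^ 2) := by gcongr
  have h4 : W ^ 2 * (W + 1) * (q + 1) ≤ 4 * (κ * W ^ 4 * q ^ 2) := by
    calc W ^ 2 * (W + 1) * (q + 1) ≤ W ^ 2 * (W + W) * (q + q) := by gcongr
      _ = 4 * (1 * (W ^ 3 * 1) * (q * 1)) := by ring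
      _ ≤ 4 * (κ * (W ^ 3 * W) * (q * q)) := by gcongr
      _ = _ := by ring
  have h5 : κ * W ^ 4 * ((W + 1) ^ 2 * (2 * q + 1)) ≤ 12 * (κ * W ^ 4 * q ^ 2) := by
    calc κ * W ^ 4 * ((W + 1) ^ 2 * (2 * q + 1)) ≤ κ * W ^ 4 * ((W + W) ^ 2 * (2 * q + q)) := by
          gcongr
      _ = 12 * (κ * W ^ 4 * (W ^ 2 * q)) := by ring
      _ ≤ 12 * (κ * W ^ 4 * (q * q)) := by gcongr
      _ = _ := by ring
  have e : topValue a K κ β A W H (q + 1) - (κ * (W ^ 3 * q) ^ 2 - spread a K β A H q) =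
      W ^ 2 * (W + 1) * (q + 1) + κ * W ^ 4 * ((W + 1) ^ 2 * (2 * q + 1)) +
      2 * (κ * W ^ 5 * q ^ 2) + κ * W ^ 4 * q ^ 2 +
      spread a K β A H (q + 1) + spread a K β A H q := by
    rw [topValue]; ring
  rw [e]
  have h0 : 0 ≤ κ * W ^ 4 * q ^ 2 := by positivity
  linarith

lemma window_start_nonneg (d : FibreData a r V W K κ β A T) {H q : ℤ} (hq : 1 ≤ q) (hH : H ≤ q) :
    0 ≤ κ * (W ^ 3 * q) ^ 2 - spread a K β A H q := by
  have hκ := d.κ_pos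
  have hV := d.V_pos
  have hW := d.W_pos
  have h1 := d.spread_le hq hH
  have h2 : 24 * V ≤ W ^ 4 := by
    rw [d.W_eq]
    have : (2 : ℤ) ^ 7 ≤ V ^ 7 := by have := d.V_ge; gcongr
    calc 24 * V ≤ V ^ 7 * V := by gcongr; lia
      _ = _ := by ring
  have h3 : 24 * V * (W ^ 2 * κ * q ^ 2) ≤ W ^ 4 * (W ^ 2 * κ * q ^ 2) := by gcongr
  have e : κ * (W ^ 3 * q) ^ 2 = W ^ 4 * (W ^ 2 * κ * q ^ 2) := by ring
  linarith

end FibreData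

/-- The fibre over `k` has a rational point. -/
def HasPoint (a : ℤ) (r k : ℕ) : Prop :=
  ∃ y z t : ℚ, y ^ 2 - a * z ^ 2 = t ^ r + k ∧ t ^ r + (k : ℚ) ≠ 0

lemma sub_le_mul_of_le_mul {G I L x y : ℝ} (hx : 0 ≤ x) (hy : 0 ≤ y) (hI : 0 ≤ I) (hL0 : 0 ≤ L)
    (hL : L ≤ G * (1 + x)) (hG : G ≤ I * (1 + y)) : L - I ≤ (x + y) * L := by
  have h1 : L ≤ I * (1 + y) * (1 + x) := hL.trans (by gcongr)
  by_cases h : x + y ≤ 1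
  · have h2 : L * (1 - x - y) ≤ I * (1 + y) * (1 + x) * (1 - x - y) :=
      mul_le_mul_of_nonneg_right h1 (by linarith)
    have h3 : (1 + y) * (1 + x) * (1 - x - y) ≤ 1 := by
      nlinarith [mul_nonneg hx hy, mul_nonneg (mul_nonneg hx hy) (add_nonneg hx hy)]
    have h4 : I * ((1 + y) * (1 + x) * (1 - x - y)) ≤ I * 1 := by gcongr
    nlinarith
  · nlinarith

open Classical in
lemma card_image_add_card_not_hasPoint_le {a : ℤ} {r M N : ℕ} (hMN : M ≤ N) (S : Finset ℤ)
    (hS : S ⊆ Ioc (M : ℤ) N)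
    (hpt : ∀ k : ℕ, (k : ℤ) ∈ S → HasPoint a r k) :
    S.card + ((Ioc M N).filter fun k => ¬ HasPoint a r k).card ≤ N - M := by
  have hdisj : Disjoint S (((Ioc M N).filter fun k => ¬ HasPoint a r k).map Nat.castEmbedding) := by
    rw [disjoint_left]
    intro k hk hk2
    simp only [Finset.mem_map, mem_filter, Nat.castEmbedding_apply] at hk2
    obtain ⟨n, hn, rfl⟩ := hk2
    exact hn.2 (hpt n hk)
  rw [← card_map (Nat.castEmbedding : ℕ ↪ ℤ) (s := (Ioc M N).filter fun k => ¬ HasPoint a r k),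
    ← card_union_of_disjoint hdisj]
  have hsub : S ∪ (((Ioc M N).filter fun k => ¬ HasPoint a r k).map Nat.castEmbedding) ⊆
      Ioc (M : ℤ) N := by
    refine union_subset hS fun k hk => ?_
    simp only [Finset.mem_map, mem_filter, mem_Ioc, Nat.castEmbedding_apply] at hk ⊢
    obtain ⟨n, hn, rfl⟩ := hk
    exact_mod_cast hn.1
  refine (card_le_card hsub).trans ?_
  rw [Int.card_Ioc]
  lia

open Classical in
theorem FibreData.exists_window {a : ℤ} {r : ℕ} {V W K κ β A : ℤ} {T : ℕ}
    (d : FibreData a r V W K κ β A T) {w c m N : ℕ} {q : ℤ} (hc : 2 ≤ c) (hm : 0 < m)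
    (hwc : c ^ m ≤ w) (hV : ∀ p : ℕ, p.Prime → p ≤ w → (p : ℤ) ∣ V)
    (hVc : V ^ (r * (8 * r + 14)) ≤ (c : ℤ) ^ w)
    (hq : V ^ (r * (8 * r + 14) + 2) ≤ q)
    (hN : topValue a K κ β A W (V ^ (r * (8 * r + 14))) q ≤ N)
    (hN' : N < topValue a K κ β A W (V ^ (r * (8 * r + 14))) (q + 1))
    (hlog : 64 + 16 * Real.log q ≤ V ^ (2 * r + 6)) :
    ∃ M < N, (((Ioc M N).filter fun k => ¬ HasPoint a r k).card : ℝ) ≤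
      (94 / V ^ 2 + 16 / m) * (N - M) := by
  set H := V ^ (r * (8 * r + 14)) with hH
  have hV0 := d.V_pos
  have hV1 : 1 ≤ V := hV0
  have hκ := d.κ_pos
  have hW := d.W_pos
  have hr := d.two_le_r
  have hexp : 2 * r + 6 ≤ r * (8 * r + 14) + 2 := by nlinarith
  have hq1 : 1 ≤ q := le_trans (one_le_pow₀ hV1) hq
  have hHq : H ≤ q := le_trans (pow_le_pow_right₀ hV1 (by lia)) hq
  have hHWq : H * W ≤ q := by rw [d.W_eq, hH, ← pow_add]; exact hq
  have hKq : 4 * κ * W ^ 3 ≤ q := by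
    refine le_trans (le_of_eq ?_) ((pow_le_pow_right₀ hV1 hexp).trans hq)
    rw [← d.K_eq_κ, d.K_eq, d.W_eq]
    ring
  have hWq : W ^ 2 ≤ q := by
    refine le_trans (le_trans (le_of_eq ?_) (pow_le_pow_right₀ hV1 (by lia : 4 ≤ 2 * r + 6)))
      ((pow_le_pow_right₀ hV1 hexp).trans hq)
    rw [d.W_eq]
    ring
  have hτ : ∑ l ∈ Icc 1 q.toNat, 1 / (l : ℝ) ≤ 1 + Real.log q := by
    have h1 := harmonic_le_one_add_log q.toNat
    have h2 : ((q.toNat : ℕ) : ℝ) = q := by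
      rw [← Int.cast_natCast, Int.toNat_of_nonneg (by lia)]
    rw [h2, harmonic_eq_sum_Icc] at h1
    push_cast at h1
    simpa only [one_div] using h1
  have hT : (24 + 8 * (1 + Real.log q) + 2 * (κ : ℝ) * W ^ 3) * W ≤ T := by
    have hT1 : (T : ℝ) = V ^ (2 * r + 6) * W := by
      have : (T : ℤ) = V ^ (2 * r + 6) * W := by rw [d.T_eq, d.W_eq]; ring
      exact_mod_cast this
    have hK1 : 4 * (κ : ℝ) * W ^ 3 = V ^ (2 * r + 6) := by
      have : 4 * κ * W ^ 3 = V ^ (2 * r + 6) := by rw [← d.K_eq_κ, d.K_eq, d.W_eq]; ring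
      exact_mod_cast this
    rw [hT1]
    refine mul_le_mul_of_nonneg_right ?_ (by exact_mod_cast hW.le)
    linarith
  have hmain := mul_sq_le_card_image_shiftedValue (c := a * K) (h := numerShift r K A) (T := T)
    (σ := 2 / m) hκ hW d.W_eq_β d.A_ne d.even_κ d.even_β d.isCoprime_A d.isCoprime_two_mul_κ hKq
    (by positivity)
    (fun i hi j hj => le_trans
      (mul_le_mul_of_nonneg_right (d.abs_numerShift_sub_le hi hj) hW.le) hHWq)
    (fun i _ j _ hij => d.numerShift_sub_ne hij)
    (fun i hi j hj hij => sum_coprimeDivisors_le hc hm hwc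
      (fun p hp hpw => (hV p hp hpw).trans d.V_dvd_β) (d.numerShift_sub_ne hij)
      ((d.abs_numerShift_sub_le hi hj).trans hVc))
    hτ d.T_pos hT
  set s := Ioc (W ^ 3 * q) (W ^ 3 * q + W ^ 2 * q) ×ˢ Ioc q (2 * q) ×ˢ range T with hs
  set S := s.image (shiftedValue κ β A (a * K) (numerShift r K A)) with hS
  obtain ⟨M, hM⟩ := Int.eq_ofNat_of_zero_le (d.window_start_nonneg hq1 hHq)
  have hSsub : S ⊆ Ioc (M : ℤ) N := by
    intro k hk
    obtain ⟨v, hv, rfl⟩ := mem_image.1 hk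
    have h1 := d.shiftedValue_mem (by lia) (fun i hi => d.abs_numerShift_le hi) hv
    rw [mem_Ioc] at h1 ⊢
    exact ⟨hM ▸ h1.1, h1.2.trans hN⟩
  have hMN : M < N := by
    have h1 : (W ^ 3 * q + W ^ 2 * q, 2 * q, 0) ∈ s := by
      simp only [hs, mem_product, mem_Ioc, mem_range]
      have : 0 < W ^ 2 * q := by positivity
      exact ⟨by lia, by lia, d.T_pos⟩
    have h2 := mem_Ioc.1 (hSsub (mem_image_of_mem _ h1))
    have := h2.1.trans_le h2.2
    exact_mod_cast this
  refine ⟨M, hMN, ?_⟩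
  have hcard := card_image_add_card_not_hasPoint_le (a := a) (r := r) hMN.le S hSsub
    fun k hk => by
      obtain ⟨v, -, hv⟩ := mem_image.1 hk
      simpa [HasPoint] using d.exists_rational_point hv.symm
  have hlen : ((N : ℝ) - M) ≤ 2 * κ * W ^ 5 * q ^ 2 * (1 + 70 / W) := by
    have h1 := d.window_length_le hWq hHq
    have h2 : (N : ℤ) - M ≤ 2 * (κ * W ^ 5 * q ^ 2) + 140 * (κ * W ^ 4 * q ^ 2) := by
      rw [hM] at h1
      lia
    have hWR : (W : ℝ) ≠ 0 := by exact_mod_cast hW.ne'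
    have h3 : (2 * (κ : ℝ) * W ^ 5 * q ^ 2 * (1 + 70 / W)) =
      2 * (κ * W ^ 5 * q ^ 2) + 140 * (κ * W ^ 4 * q ^ 2) := by field_simp; ring
    rw [h3]
    exact_mod_cast h2
  have hWR : (0 : ℝ) < W := by exact_mod_cast hW
  have hWV : (V : ℝ) ^ 2 = W := by exact_mod_cast d.W_eq.symm
  have h1 := sub_le_mul_of_le_mul (x := 70 / (W : ℝ)) (y := 24 / W + 8 * (2 / m)) (by positivity)
    (by positivity) (Nat.cast_nonneg S.card)
    (sub_nonneg.2 (by exact_mod_cast hMN.le)) hlen (by rw [← add_assoc]; exact hmain)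
  have h2 : (S.card : ℝ) + (((Ioc M N).filter fun k => ¬ HasPoint a r k).card : ℝ) ≤ N - M := by
    rw [← Nat.cast_sub hMN.le]
    exact_mod_cast hcard
  have e : 70 / (W : ℝ) + (24 / W + 8 * (2 / m)) = 94 / V ^ 2 + 16 / m := by rw [hWV]; ring
  rw [e] at h1
  linarith

lemma exists_fibreData {a : ℤ} {r w : ℕ} (ha : a ≠ 0) (hr : 2 ≤ r) (hw : 2 ≤ w) (haw : |a| ≤ w) :
    ∃ (V W K κ β A : ℤ) (T : ℕ), FibreData a r V W K κ β A T ∧ 2 ^ w ≤ V ∧ V ≤ 8 ^ w ∧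
      ∀ p : ℕ, p.Prime → p ≤ w → (p : ℤ) ∣ V := by
  set b : ℕ := primorial w with hb
  have hprime : ∀ p : ℕ, p.Prime → p ≤ w → p ∣ b := fun p hp hpw =>
    dvd_prod_of_mem _ (mem_filter.2 ⟨mem_range.2 (by lia), hp⟩)
  have hb2 : 2 ≤ b := Nat.le_of_dvd (primorial_pos w) (hprime 2 Nat.prime_two hw)
  have hb4 : b ≤ 4 ^ w := primorial_le_four_pow w
  obtain ⟨v, hv⟩ : ∃ v : ℤ, ((2 : ℤ) ^ w * b) = 2 * v := by
    obtain ⟨s, hs⟩ := Nat.exists_eq_add_of_le' (by lia : 1 ≤ w)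
    exact ⟨2 ^ s * b, by rw [hs]; ring⟩
  obtain ⟨s, hs⟩ := Nat.exists_eq_add_of_le' (by lia : 1 ≤ r)
  have hVge : (2 : ℤ) ^ w * 2 ≤ 2 ^ w * b := by gcongr; exact_mod_cast hb2
  have h2w : (w : ℤ) < 2 ^ w := by exact_mod_cast Nat.lt_two_pow_self
  have hpV : ∀ p : ℕ, p.Prime → p ≤ w → (p : ℤ) ∣ 2 ^ w * b := fun p hp hpw =>
    (Int.natCast_dvd_natCast.2 (hprime p hp hpw)).mul_left _
  refine ⟨2 ^ w * b, (2 ^ w * b) ^ 2, (2 ^ w * b) ^ (2 * r), (2 ^ w * b) ^ (2 * s) * v ^ 2,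
    2 * v ^ 2, 2 * a * (2 ^ w * b) ^ (2 * r) * (2 ^ w * b) ^ 2, (2 ^ w * b) ^ (2 * r + 8),
    ⟨ha, hr, by lia, ⟨v, hv⟩, ?_, by lia, rfl, rfl, ?_, ?_, rfl, by push_cast; rfl⟩, by lia, ?_, hpV⟩
  · intro p hp hpa
    have h1 : (p.natAbs : ℤ) ∣ 2 ^ w * b := by
      refine hpV _ (Int.prime_iff_natAbs_prime.1 hp) ?_
      have := Int.natAbs_le_of_dvd_ne_zero hpa ha
      rw [Int.abs_eq_natAbs] at haw
      lia
    exact Int.natAbs_dvd.1 h1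
  · rw [hs, mul_add, pow_add]
    nth_rewrite 2 [hv]
    ring
  · rw [hv]; ring
  · calc (2 : ℤ) ^ w * b ≤ 2 ^ w * 4 ^ w := by gcongr; exact_mod_cast hb4
      _ = 8 ^ w := by rw [← mul_pow]; norm_num

lemma FibreData.le_topValue {a : ℤ} {r : ℕ} {V W K κ β A : ℤ} {T : ℕ}
    (d : FibreData a r V W K κ β A T) {H q : ℤ} (hH : 0 ≤ H) (hq : 0 ≤ q) :
    q ≤ topValue a K κ β A W H q := by
  have hκ := d.κ_pos
  have hW : 1 ≤ W := d.W_pos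
  have hK := d.K_pos
  have hβ : 0 < β := by have := d.W_eq_β; lia
  have h1 : 0 ≤ spread a K β A H q := by rw [spread]; positivity
  have h2 : 1 * q ≤ W ^ 2 * q := by
    gcongr
    exact one_le_pow₀ hW
  have h3 : 0 ≤ W ^ 3 * q + κ * (W ^ 3 * q + W ^ 2 * q) ^ 2 := by positivity
  rw [topValue]
  linarith

lemma FibreData.topValue_le {a : ℤ} {r : ℕ} {V W K κ β A : ℤ} {T : ℕ}
    (d : FibreData a r V W K κ β A T) {H q : ℤ} (hq : 1 ≤ q) (hHq : H ≤ q) :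
    topValue a K κ β A W H q ≤ V ^ (2 * r + 17) * q ^ 2 := by
  have hκ : 1 ≤ κ := d.κ_pos
  have hW : 1 ≤ W := d.W_pos
  have hV := d.V_pos
  have h1 := d.spread_le_main hq hHq
  have h2 : W ^ 3 * q + W ^ 2 * q ≤ 2 * (W ^ 3 * q) := by
    have : W ^ 2 * q ≤ W ^ 3 * q := by gcongr; lia
    linarith
  have h3 : κ * (W ^ 3 * q + W ^ 2 * q) ^ 2 ≤ κ * (2 * (W ^ 3 * q)) ^ 2 := by gcongr
  have h4 : 1 * W ^ 3 * (q * 1) ≤ κ * W ^ 6 * (q * q) := by gcongr; lia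
  have h5 : κ * W ^ 4 * q ^ 2 ≤ κ * W ^ 6 * q ^ 2 := by gcongr; lia
  have h6 : κ * W ^ 6 * q ^ 2 ≤ K * W ^ 6 * q ^ 2 := by
    have := d.K_eq_κ
    gcongr
    lia
  have h7 : K * W ^ 6 = V ^ (2 * r + 12) := by rw [d.K_eq, d.W_eq]; ring
  have h8 : (2 : ℤ) ^ 5 ≤ V ^ 5 := by have := d.V_ge; gcongr
  have h9 : 32 * (V ^ (2 * r + 12) * q ^ 2) ≤ V ^ 5 * (V ^ (2 * r + 12) * q ^ 2) := by
    gcongr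
    lia
  have e : V ^ 5 * (V ^ (2 * r + 12) * q ^ 2) = V ^ (2 * r + 17) * q ^ 2 := by ring
  rw [h7] at h6
  have h10 : 0 ≤ κ * W ^ 6 * q ^ 2 := by positivity
  rw [topValue]
  linarith

lemma exists_crossing (f : ℕ → ℤ) (hf : ∀ n : ℕ, (n : ℤ) ≤ f n) {q₀ N : ℕ} (h : f q₀ ≤ N) :
    ∃ q ≥ q₀, f q ≤ N ∧ N < f (q + 1) := by
  by_contra! hcon
  have h1 : ∀ q ≥ q₀, f q ≤ N := fun q hq => Nat.le_induction h (fun n hn => hcon n hn) q hq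
  have h2 := h1 (q₀ + N + 1) (by lia)
  have h3 := hf (q₀ + N + 1)
  lia

open Classical in
lemma exists_window_of_scale {a : ℤ} {r w m N : ℕ} (ha : a ≠ 0) (hr : 2 ≤ r) (hw : 2 ≤ w)
    (haw : |a| ≤ w) (hm : 0 < m) (hmw : (8 ^ (r * (8 * r + 14))) ^ m ≤ w)
    (hw2 : 3 * (2 * r + 17 + 2 * (r * (8 * r + 14) + 2)) * w ≤ 2 ^ w)
    (hN : 2 ^ 2 ^ w ≤ N) (hN' : N < 2 ^ 2 ^ (w + 1)) :
    ∃ M < N, (((Ioc M N).filter fun k => ¬ HasPoint a r k).card : ℝ) ≤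
      (94 / 2 ^ w + 16 / m) * (N - M) := by
  obtain ⟨V, W, K, κ, β, A, T, d, hVge, hVle, hVp⟩ := exists_fibreData ha hr hw haw
  set C := r * (8 * r + 14) with hC
  have hV0 := d.V_pos
  have hV1 : 1 ≤ V := hV0
  have hVnat : ((V ^ (C + 2)).toNat : ℤ) = V ^ (C + 2) := Int.toNat_of_nonneg (by positivity)
  obtain ⟨q, hq, hqN, hqN'⟩ := exists_crossing
    (fun n => topValue a K κ β A W (V ^ C) n)
    (fun n => d.le_topValue (by positivity) (by positivity)) (q₀ := (V ^ (C + 2)).toNat) (N := N) (by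
      rw [hVnat]
      refine (d.topValue_le (one_le_pow₀ hV1) (pow_le_pow_right₀ hV1 (by lia))).trans ?_
      calc V ^ (2 * r + 17) * (V ^ (C + 2)) ^ 2 = V ^ (2 * r + 17 + 2 * (C + 2)) := by ring
        _ ≤ (8 ^ w) ^ (2 * r + 17 + 2 * (C + 2)) := by gcongr
        _ = 2 ^ (3 * (2 * r + 17 + 2 * (C + 2)) * w) := by
            rw [show (8 : ℤ) = 2 ^ 3 by norm_num, ← pow_mul, ← pow_mul]
            congr 1
            ring
        _ ≤ 2 ^ 2 ^ w := pow_le_pow_right₀ (by norm_num) hw2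
        _ ≤ N := by exact_mod_cast hN)
  have hqV : V ^ (C + 2) ≤ (q : ℤ) := by rw [← hVnat]; exact_mod_cast hq
  have hqpos : 0 < q := by
    have : (0 : ℤ) < q := lt_of_lt_of_le (by positivity) hqV
    exact_mod_cast this
  have hlog : 64 + 16 * Real.log ((q : ℤ) : ℝ) ≤ V ^ (2 * r + 6) := by
    have h1 : q ≤ 2 ^ 2 ^ (w + 1) := by
      have h2 := (d.le_topValue (H := V ^ C) (q := q) (by positivity) (by positivity)).trans hqN
      have h3 : q ≤ N := by exact_mod_cast h2
      exact h3.trans hN'.le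
    have h2 : Real.log q ≤ 2 ^ (w + 1) := by
      calc Real.log q ≤ Real.log (2 ^ 2 ^ (w + 1)) := by
            refine Real.log_le_log (by exact_mod_cast hqpos) ?_
            exact_mod_cast h1
        _ = 2 ^ (w + 1) * Real.log 2 := by rw [Real.log_pow]; push_cast; ring
        _ ≤ 2 ^ (w + 1) * 1 := by
            gcongr
            have := Real.log_two_lt_d9
            linarith
        _ = _ := mul_one _
    have h3 : (2 : ℝ) ^ w ≤ V := by exact_mod_cast hVge
    have h4 : (4 : ℝ) ≤ 2 ^ w := by
      calc (4 : ℝ) = 2 ^ 2 := by norm_num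
        _ ≤ 2 ^ w := pow_le_pow_right₀ (by norm_num) hw
    have h5 : (V : ℝ) ^ 10 ≤ V ^ (2 * r + 6) :=
      pow_le_pow_right₀ (by exact_mod_cast hV1) (by lia)
    have h6 : (4 : ℝ) ^ 9 * V ≤ V ^ 9 * V := by
      gcongr
      linarith
    have h7 : (2 : ℝ) ^ (w + 1) = 2 * 2 ^ w := by ring
    rw [Int.cast_natCast]
    nlinarith
  obtain ⟨M, hM, hcard⟩ := d.exists_window (w := w) (c := 8 ^ C) (m := m) (N := N) (q := q)
    (by
      have : 0 < C := by positivity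
      calc 2 ≤ 8 ^ 1 := by norm_num
        _ ≤ 8 ^ C := Nat.pow_le_pow_right (by norm_num) this) hm hmw hVp
    (by
      push_cast
      rw [pow_right_comm]
      exact pow_le_pow_left₀ hV0.le hVle C) hqV hqN (by exact_mod_cast hqN') hlog
  refine ⟨M, hM, hcard.trans ?_⟩
  have h1 : (0 : ℝ) ≤ N - M := sub_nonneg.2 (by exact_mod_cast hM.le)
  have h2 : (2 : ℝ) ^ w ≤ V ^ 2 := by
    have h3 : V ≤ V ^ 2 := d.W_eq ▸ d.V_le_W
    exact_mod_cast hVge.trans h3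
  gcongr

open Classical in
theorem exists_window_of_pos {a : ℤ} {r : ℕ} (ha : a ≠ 0) (hr : 2 ≤ r) {ε : ℝ} (hε : 0 < ε) :
    ∃ N₀ : ℕ, ∀ N ≥ N₀, ∃ M < N,
      (((Ioc M N).filter fun k => ¬ HasPoint a r k).card : ℝ) ≤ ε * (N - M) := by
  obtain ⟨m, hm⟩ := exists_nat_gt (32 / ε)
  have hm0 : (0 : ℝ) < m := lt_trans (by positivity) hm
  have hmε : 16 / (m : ℝ) ≤ ε / 2 := by
    rw [div_lt_iff₀ hε] at hm
    rw [div_le_div_iff₀ hm0 two_pos]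
    linarith
  set D := 3 * (2 * r + 17 + 2 * (r * (8 * r + 14) + 2)) with hD
  have hev : ∀ᶠ w : ℕ in Filter.atTop, D * w ≤ 2 ^ w := by
    have h1 := tendsto_pow_const_div_const_pow_of_one_lt 1 (one_lt_two : (1 : ℝ) < 2)
    filter_upwards [h1.eventually (gt_mem_nhds (by positivity : (0 : ℝ) < 1 / (D + 1)))] with w hw
    rw [pow_one, div_lt_div_iff₀ (by positivity) (by positivity)] at hw
    have h2 : (D : ℝ) * w ≤ 2 ^ w := by
      have : (0 : ℝ) ≤ w := Nat.cast_nonneg w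
      linarith
    exact_mod_cast h2
  have hev' : ∀ᶠ w : ℕ in Filter.atTop, 94 / (2 : ℝ) ^ w ≤ ε / 2 := by
    filter_upwards [(tendsto_pow_atTop_atTop_of_one_lt
      (one_lt_two : (1 : ℝ) < 2)).eventually_ge_atTop (188 / ε)] with w hw
    rw [div_le_iff₀ hε] at hw
    rw [div_le_div_iff₀ (by positivity) two_pos]
    linarith
  obtain ⟨w₀, hw₀⟩ := Filter.eventually_atTop.1 (hev.and (hev'.and
    (Filter.eventually_ge_atTop (2 + a.natAbs + (8 ^ (r * (8 * r + 14))) ^ m))))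
  refine ⟨2 ^ 2 ^ w₀, fun N hN => ?_⟩
  have hN0 : N ≠ 0 := by
    have : 0 < 2 ^ 2 ^ w₀ := by positivity
    lia
  have hlog : 2 ^ w₀ ≤ Nat.log 2 N := Nat.le_log_of_pow_le one_lt_two hN
  have hlog0 : Nat.log 2 N ≠ 0 := by
    have : 0 < 2 ^ w₀ := by positivity
    lia
  set w := Nat.log 2 (Nat.log 2 N) with hw
  obtain ⟨h1, h2, h3⟩ := hw₀ w (Nat.le_log_of_pow_le one_lt_two hlog)
  obtain ⟨M, hM, hcard⟩ := exists_window_of_scale (w := w) (m := m) (N := N) ha hr (by lia)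
    (by rw [Int.abs_eq_natAbs]; exact_mod_cast (by lia : a.natAbs ≤ w)) (by exact_mod_cast hm0)
    (by lia) h1
    ((Nat.pow_le_pow_right two_pos (Nat.pow_log_le_self 2 hlog0)).trans
      (Nat.pow_log_le_self 2 hN0))
    ((Nat.lt_pow_succ_log_self one_lt_two N).trans_le
      (Nat.pow_le_pow_right two_pos (Nat.lt_pow_succ_log_self one_lt_two _)))
  refine ⟨M, hM, hcard.trans (mul_le_mul_of_nonneg_right (by linarith) ?_)⟩
  exact sub_nonneg.2 (by exact_mod_cast hM.le)

lemma card_filter_Ioc_le_of_windows {P : ℕ → Prop} [DecidablePred P] {ε : ℝ} (hε : 0 ≤ ε) {N₀ : ℕ}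
    (h : ∀ N ≥ N₀, ∃ M < N, (((Ioc M N).filter P).card : ℝ) ≤ ε * (N - M)) (N : ℕ) :
    (((Ioc 0 N).filter P).card : ℝ) ≤ N₀ + ε * N := by
  induction N using Nat.strong_induction_on with
  | _ N ih =>
    by_cases hN : N₀ ≤ N
    · obtain ⟨M, hM, hcard⟩ := h N hN
      have h1 := ih M hM
      have h2 : ((Ioc 0 N).filter P).card ≤ ((Ioc 0 M).filter P).card + ((Ioc M N).filter P).card := by
        rw [← Ioc_union_Ioc_eq_Ioc (Nat.zero_le M) hM.le, filter_union]
        exact card_union_le _ _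
      have h3 : (((Ioc 0 N).filter P).card : ℝ) ≤
          ((Ioc 0 M).filter P).card + ((Ioc M N).filter P).card := by exact_mod_cast h2
      linarith
    · have h1 : ((Ioc 0 N).filter P).card ≤ N₀ := by
        refine (card_filter_le _ _).trans ?_
        rw [Nat.card_Ioc]
        lia
      have h2 : (((Ioc 0 N).filter P).card : ℝ) ≤ N₀ := by exact_mod_cast h1
      have : 0 ≤ ε * N := by positivity
      linarith

lemma tendsto_ncard_div_of_windows {P : ℕ → Prop} [DecidablePred P]
    (h : ∀ ε : ℝ, 0 < ε → ∃ N₀ : ℕ, ∀ N ≥ N₀, ∃ M < N,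
      (((Ioc M N).filter fun k => ¬ P k).card : ℝ) ≤ ε * (N - M)) :
    Filter.Tendsto (fun N : ℕ => ({k : ℕ | 1 ≤ k ∧ k ≤ N ∧ P k}.ncard : ℝ) / N)
      Filter.atTop (nhds 1) := by
  have hcount : ∀ N : ℕ, ({k : ℕ | 1 ≤ k ∧ k ≤ N ∧ P k}.ncard : ℝ) =
      N - ((Ioc 0 N).filter fun k => ¬ P k).card := by
    intro N
    have h1 : {k : ℕ | 1 ≤ k ∧ k ≤ N ∧ P k} = ((Ioc 0 N).filter P : Finset ℕ) := by
      ext k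
      simp [Nat.succ_le_iff, and_assoc]
    rw [h1, Set.ncard_coe_finset]
    have h2 := card_filter_add_card_filter_not (s := Ioc 0 N) P
    rw [Nat.card_Ioc, Nat.sub_zero] at h2
    have h3 : (((Ioc 0 N).filter P).card : ℝ) + ((Ioc 0 N).filter fun k => ¬ P k).card = N := by
      exact_mod_cast h2
    linarith
  rw [Metric.tendsto_atTop]
  intro ε hε
  obtain ⟨N₀, hN₀⟩ := h (ε / 2) (by positivity)
  obtain ⟨N₁, hN₁⟩ := exists_nat_gt (2 * N₀ / ε)
  refine ⟨N₁ + 1, fun N hN => ?_⟩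
  have hNR : (N₁ : ℝ) + 1 ≤ N := by exact_mod_cast hN
  have hN0 : (0 : ℝ) < N := by
    have : (0 : ℝ) ≤ N₁ := Nat.cast_nonneg _
    linarith
  have hbad := card_filter_Ioc_le_of_windows (by positivity) hN₀ N
  rw [hcount, Real.dist_eq, abs_sub_comm, sub_div, div_self hN0.ne', sub_sub_cancel,
    abs_of_nonneg (by positivity), div_lt_iff₀ hN0]
  rw [div_lt_iff₀ hε] at hN₁
  nlinarith

end DensityOne

/-- Let `a ∈ ℤ - {0,1}` be squarefree with `a ≡ 1 (mod 4)` (equivalently, `2` does not ramify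
in the ring of integers of `ℚ(√a)`), and let `r` be a prime such that `p ≢ 1 (mod r)` for all
primes `p ∣ a`. Then the set of positive integers `k` such that the variety
`y² - a z² = t^r + k ≠ 0` has a rational point has natural density `1`. -/
theorem chatelet_rational_points_density_one
    (a : ℤ) (ha0 : a ≠ 0) (ha1 : a ≠ 1) (hsf : Squarefree a) (ha4 : a % 4 = 1)
    (r : ℕ) (hr : r.Prime)
    (hp : ∀ p : ℕ, p.Prime → (p : ℤ) ∣ a → ¬ p ≡ 1 [MOD r]) :
    Tendsto (fun N : ℕ =>
        ({k : ℕ | 1 ≤ k ∧ k ≤ N ∧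
            ∃ y z t : ℚ, y ^ 2 - a * z ^ 2 = t ^ r + k ∧ t ^ r + (k : ℚ) ≠ 0}.ncard : ℝ) / N)
      atTop (nhds 1) := by
  classical
  exact tendsto_ncard_div_of_windows (P := HasPoint a r)
    fun _ hε => exists_window_of_pos ha0 hr.two_le hε
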